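/- arXiv:math/0610011 — 6 statements merged into one kernel-verified Lean document; each statement's English description precedes it below -/
import Mathlib

section
/- There exists a constant C > 0 such that for every f ∈ L¹(λ) and every η > 0, λ({x ∈ ℝ : T*_μ f(x) > η}) ≤ (C/η) ∫_ℝ |f(y)| dλ(y). -/
open MeasureTheory Real Set

/-- The measure dλ(x) = |x|^{2μ} e^{-x²} dx on ℝ. -/
noncomputable def lam (μ : ℝ) : Measure ℝ :=
  volume.withDensity (fun x => ENNReal.ofReal (|x| ^ (2 * μ) * Real.exp (-x ^ 2)))

/-- The generalized factorial γ_μ: γ_μ(2m) = 2^{2m} m! Γ(m+μ+1/2)/Γ(μ+1/2),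
γ_μ(2m+1) = 2^{2m+1} m! Γ(m+μ+3/2)/Γ(μ+1/2). -/
noncomputable def genGamma (μ : ℝ) (n : ℕ) : ℝ :=
  if Even n then
    2 ^ n * (Nat.factorial (n / 2)) * Real.Gamma (((n / 2 : ℕ) : ℝ) + μ + 1 / 2) /
      Real.Gamma (μ + 1 / 2)
  else
    2 ^ n * (Nat.factorial (n / 2)) * Real.Gamma (((n / 2 : ℕ) : ℝ) + μ + 3 / 2) /
      Real.Gamma (μ + 1 / 2)

/-- The generalized exponential function e_μ(x) = Σ_{m} x^m / γ_μ(m). -/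
noncomputable def genExp (μ : ℝ) (x : ℝ) : ℝ := ∑' m : ℕ, x ^ m / genGamma μ m

/-- The kernel K_r(x,y) = (Γ(μ+1/2)(1-r²)^{μ+1/2})⁻¹ e^{-(x²+y²)r²/(1-r²)} e_μ(2xyr/(1-r²)). -/
noncomputable def K (μ r x y : ℝ) : ℝ :=
  (Real.Gamma (μ + 1 / 2) * (1 - r ^ 2) ^ (μ + 1 / 2))⁻¹ *
    (Real.exp (-(x ^ 2 + y ^ 2) * r ^ 2 / (1 - r ^ 2)) *
      genExp μ (2 * x * y * r / (1 - r ^ 2)))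

/-- The generalized Ornstein–Uhlenbeck maximal function
T*_μ f(x) = sup_{0<r<1} |∫ K_r(x,y) f(y) dλ(y)|. -/
noncomputable def Tstar (μ : ℝ) (f : ℝ → ℝ) (x : ℝ) : ℝ :=
  ⨆ r : Set.Ioo (0 : ℝ) 1, |∫ y, K μ (r : ℝ) x y * f y ∂(lam μ)|

/-- Among three order-connected sets with a common point, one lies in the union of the other two. -/
lemma Set.OrdConnected.subset_union_of_three {A B C : Set ℝ} (hA : A.OrdConnected)
    (hB : B.OrdConnected) (hC : C.OrdConnected) {x : ℝ} (hxA : x ∈ A) (hxB : x ∈ B)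
    (hxC : x ∈ C) : A ⊆ B ∪ C ∨ B ⊆ A ∪ C ∨ C ⊆ A ∪ B := by
  by_contra! h
  obtain ⟨h₁, h₂, h₃⟩ := h
  obtain ⟨a, haA, ha⟩ := not_subset.1 h₁
  obtain ⟨b, hbB, hb⟩ := not_subset.1 h₂
  obtain ⟨c, hcC, hc⟩ := not_subset.1 h₃
  simp only [mem_union, not_or] at ha hb hc
  have key : ∀ {S : Set ℝ} {p q : ℝ}, S.OrdConnected → x ∈ S → p ∈ S → q ∉ S →
      ¬ (x ≤ q ∧ q ≤ p) ∧ ¬ (p ≤ q ∧ q ≤ x) := fun hS hx hp hq =>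
    ⟨fun h => hq (hS.out hx hp h), fun h => hq (hS.out hp hx h)⟩
  have hAb := key hA hxA haA hb.1
  have hAc := key hA hxA haA hc.1
  have hBa := key hB hxB hbB ha.1
  have hBc := key hB hxB hbB hc.2
  have hCa := key hC hxC hcC ha.2
  have hCb := key hC hxC hcC hb.2
  grind

/-- A finite family of order-connected subsets of `ℝ` has a subfamily with the same union
covering no point more than twice. -/
lemma exists_subfamily_card_le_two (s : Finset (Set ℝ)) (hs : ∀ I ∈ s, I.OrdConnected) :
    ∃ t ⊆ s, (⋃ I ∈ t, I) = (⋃ I ∈ s, I) ∧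
      ∀ x : ℝ, {I : Set ℝ | I ∈ t ∧ x ∈ I}.ncard ≤ 2 := by
  classical
  induction s using Finset.strongInduction with
  | H s ih =>
  by_cases h : ∀ x : ℝ, {I : Set ℝ | I ∈ s ∧ x ∈ I}.ncard ≤ 2
  · exact ⟨s, subset_rfl, rfl, h⟩
  push Not at h
  obtain ⟨x, hx⟩ := h
  have drop : ∀ A ∈ s, ∀ B ∈ s, ∀ C ∈ s, A ≠ B → A ≠ C → A ⊆ B ∪ C →
      ∃ t ⊆ s, (⋃ I ∈ t, I) = (⋃ I ∈ s, I) ∧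
        ∀ x : ℝ, {I : Set ℝ | I ∈ t ∧ x ∈ I}.ncard ≤ 2 := by
    intro A hA B hB C hC hAB hAC hsub
    obtain ⟨t, ht, htU, htc⟩ := ih (s.erase A) (Finset.erase_ssubset hA)
      fun I hI => hs I (Finset.mem_of_mem_erase hI)
    refine ⟨t, ht.trans (Finset.erase_subset _ _), htU.trans (subset_antisymm ?_ ?_), htc⟩
    · exact biUnion_subset_biUnion_left fun I hI => Finset.mem_of_mem_erase hI
    · refine iUnion₂_subset fun I hI y hy => ?_
      simp only [mem_iUnion, Finset.mem_erase, exists_prop]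
      by_cases hIA : I = A
      · subst hIA
        rcases hsub hy with h | h
        · exact ⟨B, ⟨hAB.symm, hB⟩, h⟩
        · exact ⟨C, ⟨hAC.symm, hC⟩, h⟩
      · exact ⟨I, ⟨hIA, hI⟩, hy⟩
  have hfin : {I : Set ℝ | I ∈ s ∧ x ∈ I} = (s.filter fun I => x ∈ I : Finset (Set ℝ)) := by
    ext; simp
  rw [hfin, ncard_coe_finset, Finset.two_lt_card] at hx
  obtain ⟨A, hA, B, hB, C, hC, hAB, hAC, hBC⟩ := hx
  rw [Finset.mem_filter] at hA hB hC
  rcases Set.OrdConnected.subset_union_of_three (hs A hA.1) (hs B hB.1) (hs C hC.1)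
    hA.2 hB.2 hC.2 with h | h | h
  · exact drop A hA.1 B hB.1 C hC.1 hAB hAC h
  · exact drop B hB.1 A hA.1 C hC.1 hAB.symm hBC h
  · exact drop C hC.1 A hA.1 B hB.1 hAC.symm hBC.symm h

open scoped ENNReal

/-- The total mass of a finite family covering no point more than twice. -/
lemma sum_measure_le_two_mul {G : Measure ℝ} (t : Finset (Set ℝ))
    (ht : ∀ I ∈ t, MeasurableSet I) (h : ∀ x : ℝ, {I : Set ℝ | I ∈ t ∧ x ∈ I}.ncard ≤ 2) :
    ∑ I ∈ t, G I ≤ 2 * G univ := by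
  classical
  calc ∑ I ∈ t, G I = ∑ I ∈ t, ∫⁻ x, I.indicator 1 x ∂G :=
        Finset.sum_congr rfl fun I hI => (lintegral_indicator_one (ht I hI)).symm
    _ = ∫⁻ x, ∑ I ∈ t, I.indicator 1 x ∂G :=
        (lintegral_finsetSum' _ fun I hI =>
          (measurable_one.indicator (ht I hI)).aemeasurable).symm
    _ ≤ ∫⁻ _, 2 ∂G := by
        refine lintegral_mono fun x => ?_
        have hfin : {I : Set ℝ | I ∈ t ∧ x ∈ I} = (t.filter fun I => x ∈ I : Finset (Set ℝ)) := by
          ext; simp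
        have hx := h x
        rw [hfin, ncard_coe_finset] at hx
        simp only [indicator_apply, Pi.one_apply, Finset.sum_boole]
        exact_mod_cast hx
    _ = 2 * G univ := by simp

/-- The union of the open intervals whose `G`-mass is at least `c` times their `ν`-mass. -/
def excessSet (ν G : Measure ℝ) (c : ℝ≥0∞) : Set ℝ :=
  ⋃ I ∈ {I : Set ℝ | IsOpen I ∧ I.OrdConnected ∧ c * ν I ≤ G I}, I

lemma isOpen_excessSet (ν G : Measure ℝ) (c : ℝ≥0∞) : IsOpen (excessSet ν G c) :=
  isOpen_biUnion fun _ hI => hI.1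

/-- Weak type (1,1) inequality for the uncentred maximal function of `G` with respect to `ν`. -/
lemma mul_measure_excessSet_le (ν G : Measure ℝ) [IsFiniteMeasure ν] (c : ℝ≥0∞) :
    c * ν (excessSet ν G c) ≤ 2 * G univ := by
  rw [(isOpen_excessSet ν G c).measure_eq_iSup_isCompact]
  simp only [ENNReal.mul_iSup]
  refine iSup₂_le fun L hL => iSup_le fun hLc => ?_
  obtain ⟨b, hb, hbf, hLb⟩ := hLc.elim_finite_subcover_image (c := id)
    (b := {I : Set ℝ | IsOpen I ∧ I.OrdConnected ∧ c * ν I ≤ G I}) (fun I hI => hI.1) hL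
  obtain ⟨t, hts, htU, htc⟩ := exists_subfamily_card_le_two hbf.toFinset
    fun I hI => (hb (hbf.mem_toFinset.1 hI)).2.1
  have hmem : ∀ I ∈ t, IsOpen I ∧ I.OrdConnected ∧ c * ν I ≤ G I :=
    fun I hI => hb (hbf.mem_toFinset.1 (hts hI))
  have hLt : L ⊆ ⋃ I ∈ t, I := by
    rw [htU]
    simpa using hLb
  calc c * ν L ≤ c * ∑ I ∈ t, ν I := by
        gcongr
        exact (measure_mono hLt).trans (measure_biUnion_finset_le t fun I => I)
    _ = ∑ I ∈ t, c * ν I := Finset.mul_sum _ _ _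
    _ ≤ ∑ I ∈ t, G I := Finset.sum_le_sum fun I hI => (hmem I hI).2.2
    _ ≤ 2 * G univ := sum_measure_le_two_mul t (fun I hI => (hmem I hI).1.measurableSet) htc

/-- Off the excess set every order-connected set has `G`-mass at most `c` times its `ν`-mass. -/
lemma measure_le_of_notMem_excessSet {ν G : Measure ℝ} [IsFiniteMeasure ν] {c : ℝ≥0∞}
    (hc₀ : c ≠ 0) (hc : c ≠ ∞) {x : ℝ} (hx : x ∉ excessSet ν G c) {J : Set ℝ}
    (hJ : J.OrdConnected) (hxJ : x ∈ J) : G J ≤ c * ν J := by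
  by_contra! h
  have h' : ν J < G J / c := by
    rwa [ENNReal.lt_div_iff_mul_lt (Or.inl hc₀) (Or.inl hc), mul_comm]
  obtain ⟨V, hJV, hV, hνV⟩ := J.exists_isOpen_lt_of_lt _ h'
  have hJc : J ⊆ connectedComponentIn V x :=
    hJ.isPreconnected.subset_connectedComponentIn hxJ hJV
  refine hx (mem_biUnion (x := connectedComponentIn V x)
    ⟨hV.connectedComponentIn, isPreconnected_connectedComponentIn.ordConnected, ?_⟩ (hJc hxJ))
  rw [ENNReal.lt_div_iff_mul_lt (Or.inl hc₀) (Or.inl hc), mul_comm] at hνV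
  calc c * ν (connectedComponentIn V x) ≤ c * ν V := by
        gcongr; exact connectedComponentIn_subset _ _
    _ ≤ G J := hνV.le
    _ ≤ G (connectedComponentIn V x) := measure_mono hJc

/-- A function `B` whose least unimodal majorant with mode `x` is at most `D` has
`G`-integral controlled by the `ν`-integral of `D`. -/
lemma lintegral_le_of_unimodal_majorant {ν G : Measure ℝ} {c : ℝ≥0∞} {x : ℝ}
    (hx : ∀ J : Set ℝ, J.OrdConnected → x ∈ J → G J ≤ c * ν J) (hc : c ≠ ∞)
    {B D : ℝ → ℝ} (hB₀ : 0 ≤ B) (hD₀ : 0 ≤ D) (hB : Measurable B) (hD : Measurable D)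
    (hl : ∀ y' y, y' ≤ y → y ≤ x → B y' ≤ D y) (hr : ∀ y y', x ≤ y → y ≤ y' → B y' ≤ D y) :
    ∫⁻ y, ENNReal.ofReal (B y) ∂G ≤ c * ∫⁻ y, ENNReal.ofReal (D y) ∂ν := by
  rw [lintegral_eq_lintegral_meas_lt G (ae_of_all _ hB₀) hB.aemeasurable,
    lintegral_eq_lintegral_meas_lt ν (ae_of_all _ hD₀) hD.aemeasurable,
    ← lintegral_const_mul' _ _ hc]
  refine lintegral_mono fun t => ?_
  rcases eq_empty_or_nonempty {y | t < B y} with he | ⟨z, hz⟩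
  · simp [he]
  set J : Set ℝ := {y | (y ≤ x ∧ ∃ y' ≤ y, t < B y') ∨ (x ≤ y ∧ ∃ y', y ≤ y' ∧ t < B y')}
  have hxJ : x ∈ J := by
    rcases le_total z x with h | h
    · exact Or.inl ⟨le_rfl, z, h, hz⟩
    · exact Or.inr ⟨le_rfl, z, h, hz⟩
  have hJ : J.OrdConnected := by
    refine ⟨fun p hp q hq y hy => ?_⟩
    rcases le_total y x with h | h
    · rcases hp with ⟨_, y', hy', ht⟩ | ⟨hp, -⟩
      · exact Or.inl ⟨h, y', hy'.trans hy.1, ht⟩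
      · rwa [le_antisymm h (hp.trans hy.1)]
    · rcases hq with ⟨hq, -⟩ | ⟨_, y', hy', ht⟩
      · rwa [le_antisymm (hy.2.trans hq) h]
      · exact Or.inr ⟨h, y', hy.2.trans hy', ht⟩
  calc G {y | t < B y} ≤ G J := measure_mono fun y hy => by
        rcases le_total y x with h | h
        · exact Or.inl ⟨h, y, le_rfl, hy⟩
        · exact Or.inr ⟨h, y, le_rfl, hy⟩
    _ ≤ c * ν J := hx J hJ hxJ
    _ ≤ c * ν {y | t < D y} := by
        gcongr
        rintro y (⟨h, y', hy', ht⟩ | ⟨h, y', hy', ht⟩)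
        · exact ht.trans_le (hl y' y hy' h)
        · exact ht.trans_le (hr y y' h hy')

lemma exists_rpow_le_mul_exp (k q δ : ℝ) (hk : 0 < k) (hq : 0 ≤ q) (hδ : 0 < δ) :
    ∃ C, 0 < C ∧ ∀ u, 0 ≤ u → (k * (1 + u)) ^ q ≤ C * exp (δ * u) := by
  have hq1 : 0 < q + 1 := by linarith
  set e := δ / (q + 1) with he
  have he0 : 0 < e := by positivity
  have hek : (q + 1) * e = δ := by rw [he]; field_simp
  refine ⟨(k * (1 + 1 / e)) ^ q, by positivity, fun u hu => ?_⟩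
  have h1 : 1 + u ≤ (1 + 1 / e) * exp (e * u) := by
    calc 1 + u ≤ (1 + 1 / e) * (e * u + 1) := by
          have : (1 + 1 / e) * (e * u + 1) = 1 + u + e * u + 1 / e := by field_simp; ring
          rw [this]; have : 0 ≤ e * u + 1 / e := by positivity
          linarith
      _ ≤ _ := by gcongr; exact add_one_le_exp _
  calc (k * (1 + u)) ^ q ≤ ((k * (1 + 1 / e)) * exp (e * u)) ^ q := by
        refine rpow_le_rpow (by positivity) ?_ hq
        rw [mul_assoc]; gcongr
    _ = (k * (1 + 1 / e)) ^ q * exp (e * u * q) := by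
        rw [mul_rpow (by positivity) (exp_pos _).le, ← exp_mul]
    _ ≤ _ := by
        refine mul_le_mul_of_nonneg_left (exp_le_exp.2 ?_) (by positivity)
        have : 0 ≤ e * u := by positivity
        nlinarith

lemma rpow_le_rpow_abs_mul_rpow {k p p' : ℝ} (τ : ℝ) (hp : 0 < p) (hp' : 0 < p')
    (hk : 0 < k) (h : p ≤ k * p') (h' : p' ≤ k * p) : p' ^ τ ≤ k ^ |τ| * p ^ τ := by
  rcases le_total 0 τ with hτ | hτ
  · rw [abs_of_nonneg hτ, ← mul_rpow hk.le hp.le]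
    exact rpow_le_rpow hp'.le h' hτ
  · rw [abs_of_nonpos hτ, rpow_neg hk.le, ← div_eq_inv_mul, le_div_iff₀' (by positivity),
      ← mul_rpow hk.le hp'.le]
    exact rpow_le_rpow_of_nonpos hp h hτ

/-- The model kernel: it dominates `K μ r x y` for nonnegative `x` and `y`, up to a constant. -/
noncomputable def modelKernel (μ r x y : ℝ) : ℝ :=
  (1 - r ^ 2) ^ (-(μ + 1 / 2)) * (1 + 2 * x * y * r / (1 - r ^ 2)) ^ (-μ) *
    exp ((2 * x * y * r - r ^ 2 * (x ^ 2 + y ^ 2)) / (1 - r ^ 2))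

lemma one_sub_sq_pos {r : ℝ} (hr : r ∈ Ioo (0 : ℝ) 1) : 0 < 1 - r ^ 2 := by
  nlinarith [hr.1, hr.2]

lemma modelKernel_le_mul (μ : ℝ) :
    ∃ C, 1 ≤ C ∧ ∀ r ∈ Ioo (0 : ℝ) 1, ∀ x y y' g, 0 ≤ x → 0 ≤ y → 0 ≤ y' → 0 ≤ g →
      (2 * x * y' * r - r ^ 2 * (x ^ 2 + y' ^ 2)) / (1 - r ^ 2) + g
        ≤ (2 * x * y * r - r ^ 2 * (x ^ 2 + y ^ 2)) / (1 - r ^ 2) →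
      1 + 2 * x * y * r / (1 - r ^ 2) ≤ 4 * (1 + g) * (1 + 2 * x * y' * r / (1 - r ^ 2)) →
      1 + 2 * x * y' * r / (1 - r ^ 2) ≤ 4 * (1 + g) * (1 + 2 * x * y * r / (1 - r ^ 2)) →
      modelKernel μ r x y' ≤ C * modelKernel μ r x y := by
  obtain ⟨C, hC, h⟩ := exists_rpow_le_mul_exp 4 |-μ| 1 (by norm_num) (abs_nonneg _) one_pos
  refine ⟨max C 1, le_max_right _ _, fun r hr x y y' g hx hy hy' hg hE hp hp' => ?_⟩
  have hs := one_sub_sq_pos hr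
  have hr0 := hr.1
  unfold modelKernel
  set s := 1 - r ^ 2
  set E := (2 * x * y * r - r ^ 2 * (x ^ 2 + y ^ 2)) / s
  set E' := (2 * x * y' * r - r ^ 2 * (x ^ 2 + y' ^ 2)) / s
  have hpow := rpow_le_rpow_abs_mul_rpow (-μ) (by positivity) (by positivity) (by positivity) hp hp'
  calc s ^ (-(μ + 1 / 2)) * (1 + 2 * x * y' * r / s) ^ (-μ) * exp E'
      ≤ s ^ (-(μ + 1 / 2)) * ((C * exp (1 * g)) * (1 + 2 * x * y * r / s) ^ (-μ)) * exp E' := by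
        gcongr
        exact hpow.trans (by gcongr; exact h g hg)
    _ = C * (s ^ (-(μ + 1 / 2)) * (1 + 2 * x * y * r / s) ^ (-μ) * exp (E' + g)) := by
        rw [exp_add, one_mul]; ring
    _ ≤ max C 1 * (s ^ (-(μ + 1 / 2)) * (1 + 2 * x * y * r / s) ^ (-μ) * exp E) := by
        gcongr
        exact le_max_left _ _

lemma modelKernel_quasi_unimodal (μ : ℝ) :
    ∃ C, 1 ≤ C ∧ ∀ r ∈ Ioo (0 : ℝ) 1, ∀ x y y', 0 ≤ x → 0 ≤ y → 0 ≤ y' →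
      (y' ≤ y ∧ r * y ≤ x ∨ y ≤ y' ∧ x ≤ r * y) →
      modelKernel μ r x y' ≤ C * modelKernel μ r x y := by
  obtain ⟨C, hC, h⟩ := modelKernel_le_mul μ
  refine ⟨C, hC, fun r hr x y y' hx hy hy' hyy => ?_⟩
  have hs := one_sub_sq_pos hr
  have hr0 := hr.1
  have hb : ∀ {a b k : ℝ}, 1 ≤ k → 0 ≤ b → a ≤ k * b →
      1 + a / (1 - r ^ 2) ≤ k * (1 + b / (1 - r ^ 2)) := by
    intro a b k hk hb hab
    have : a / (1 - r ^ 2) ≤ k * (b / (1 - r ^ 2)) := by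
      rw [← mul_div_assoc]; gcongr
    linarith
  set g := r * (y - y') * (2 * x - r * (y + y')) / (1 - r ^ 2) with hgdef
  have hgE : (2 * x * y' * r - r ^ 2 * (x ^ 2 + y' ^ 2)) / (1 - r ^ 2) + g
      = (2 * x * y * r - r ^ 2 * (x ^ 2 + y ^ 2)) / (1 - r ^ 2) := by
    rw [hgdef, ← add_div]; ring_nf
  have hxr : 0 ≤ x * r := by positivity
  rcases hyy with ⟨hle, hyx⟩ | ⟨hle, hyx⟩
  · have hry : r * y' ≤ r * y := by gcongr
    have hg : 0 ≤ g := by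
      have h1 : 0 ≤ 2 * x - r * (y + y') := by linarith
      have h2 : 0 ≤ y - y' := by linarith
      positivity
    refine h r hr x y y' g hx hy hy' hg hgE.le ?_ (hb (by linarith) (by positivity) ?_)
    · rcases le_total y (4 * y') with h4 | h4
      · refine hb (by linarith) (by positivity) ?_
        have : x * r * y ≤ x * r * (4 * y') := by gcongr
        have : 0 ≤ g * (x * r * y') := by positivity
        nlinarith
      · have hg' : x * y * r / (1 - r ^ 2) ≤ 2 * g := by
          rw [hgdef, ← mul_div_assoc]
          refine div_le_div_of_nonneg_right ?_ hs.le
          have h1 : r * (3 / 4 * y) ≤ r * (y - y') := by gcongr; linarith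
          have h2 : 3 / 4 * x ≤ 2 * x - r * (y + y') := by nlinarith
          have h3 : r * (3 / 4 * y) * (3 / 4 * x) ≤ r * (y - y') * (2 * x - r * (y + y')) := by
            gcongr
          have : 0 ≤ x * y * r := by positivity
          linarith
        have h1 : 1 + 2 * x * y * r / (1 - r ^ 2) ≤ 4 * (1 + g) := by
          have : 2 * x * y * r / (1 - r ^ 2) = 2 * (x * y * r / (1 - r ^ 2)) := by ring
          linarith
        refine h1.trans (le_mul_of_one_le_right (by positivity) ?_)
        have : 0 ≤ 2 * x * y' * r / (1 - r ^ 2) := by positivity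
        linarith
    · have : x * r * y' ≤ x * r * y := by gcongr
      have : 0 ≤ g * (x * r * y) := by positivity
      have : 0 ≤ x * r * y := by positivity
      nlinarith
  · have hry : r * y ≤ r * y' := by gcongr
    have hg2 : r ^ 2 * (y' - y) ^ 2 / (1 - r ^ 2) ≤ g := by
      rw [hgdef]
      refine div_le_div_of_nonneg_right ?_ hs.le
      have h1 : 0 ≤ r * (y' - y) := mul_nonneg hr0.le (by linarith)
      nlinarith
    have hg : 0 ≤ g := le_trans (by positivity) hg2
    refine h r hr x y y' g hx hy hy' hg hgE.le (hb (by linarith) (by positivity) ?_) ?_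
    · have : x * r * y ≤ x * r * y' := by gcongr
      have : 0 ≤ g * (x * r * y') := by positivity
      have : 0 ≤ x * r * y' := by positivity
      nlinarith
    · rcases le_total y' (4 * y) with h4 | h4
      · refine hb (by linarith) (by positivity) ?_
        have : x * r * y' ≤ x * r * (4 * y) := by gcongr
        have : 0 ≤ g * (x * r * y) := by positivity
        nlinarith
      · have hg' : 2 * x * y' * r / (1 - r ^ 2) ≤ r ^ 2 * (y' - y) ^ 2 / (1 - r ^ 2) * 4 := by
          rw [← mul_div_right_comm]
          refine div_le_div_of_nonneg_right ?_ hs.le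
          have h1 : x * (y' * r) ≤ r * y * (y' * r) := by gcongr
          have h2 : r ^ 2 * (y * y') ≤ r ^ 2 * (y' ^ 2 / 4) := by gcongr; nlinarith
          have h3 : r ^ 2 * (3 / 4 * y') ^ 2 ≤ r ^ 2 * (y' - y) ^ 2 := by gcongr; linarith
          have : 0 ≤ r ^ 2 * y' ^ 2 := by positivity
          nlinarith
        have h1 : 1 + 2 * x * y' * r / (1 - r ^ 2) ≤ 4 * (1 + g) := by linarith
        refine h1.trans (le_mul_of_one_le_right (by positivity) ?_)
        have : 0 ≤ 2 * x * y * r / (1 - r ^ 2) := by positivity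
        linarith

open Filter Topology in
/-- Lower bound for the ratio of two rising factorials. -/
lemma exists_mul_prod_le_prod {a b : ℝ} (ha : 0 < a) (hb : 0 < b) :
    ∃ c, 0 < c ∧ ∀ m : ℕ,
      c * ((m : ℝ) + 1) ^ (a - b) * ∏ j ∈ Finset.range m, (b + j)
        ≤ ∏ j ∈ Finset.range m, (a + j) := by
  have hpos : ∀ {d : ℝ}, 0 < d → ∀ m : ℕ, 0 < ∏ j ∈ Finset.range m, (d + j) := fun hd m =>
    Finset.prod_pos fun j _ => by positivity
  have hlim : Tendsto (fun n => GammaSeq b n / GammaSeq a n) atTop (𝓝 (Gamma b / Gamma a)) :=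
    (GammaSeq_tendsto_Gamma b).div (GammaSeq_tendsto_Gamma a) (Gamma_pos_of_pos ha).ne'
  have hL : 0 < Gamma b / Gamma a := div_pos (Gamma_pos_of_pos hb) (Gamma_pos_of_pos ha)
  obtain ⟨N, hN⟩ := eventually_atTop.1 (hlim.eventually (lt_mem_nhds (half_lt_self hL)))
  set L := Gamma b / Gamma a / 2
  have hL' : 0 < L := half_pos hL
  have hlarge : ∀ m, N + 2 ≤ m → L / 3 ^ |a - b| * ((m : ℝ) + 1) ^ (a - b) *
      ∏ j ∈ Finset.range m, (b + j) ≤ ∏ j ∈ Finset.range m, (a + j) := by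
    intro m hm
    obtain ⟨n, rfl⟩ : ∃ n, m = n + 1 := ⟨m - 1, by omega⟩
    have hn : 1 ≤ n := by omega
    have hn' : (1 : ℝ) ≤ n := by exact_mod_cast hn
    have hn0 : (0 : ℝ) < n := by linarith
    have hNn := (hN n (by omega)).le
    have hPa := hpos ha (n + 1)
    have hPb := hpos hb (n + 1)
    have hq : GammaSeq b n / GammaSeq a n = (∏ j ∈ Finset.range (n + 1), (a + j)) /
        ((n : ℝ) ^ (a - b) * ∏ j ∈ Finset.range (n + 1), (b + j)) := by
      rw [GammaSeq, GammaSeq, rpow_sub hn0]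
      field_simp
    rw [hq, le_div_iff₀ (by positivity)] at hNn
    have h3 : (((n + 1 : ℕ) : ℝ) + 1) ^ (a - b) ≤ 3 ^ |a - b| * (n : ℝ) ^ (a - b) := by
      push_cast
      exact rpow_le_rpow_abs_mul_rpow _ hn0 (by positivity) three_pos (by linarith) (by linarith)
    calc _ ≤ L / 3 ^ |a - b| * (3 ^ |a - b| * (n : ℝ) ^ (a - b)) *
          ∏ j ∈ Finset.range (n + 1), (b + j) := by gcongr
      _ = L * ((n : ℝ) ^ (a - b) * ∏ j ∈ Finset.range (n + 1), (b + j)) := by field_simp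
      _ ≤ _ := hNn
  set q : ℕ → ℝ := fun m => (∏ j ∈ Finset.range m, (a + j)) /
    (((m : ℝ) + 1) ^ (a - b) * ∏ j ∈ Finset.range m, (b + j))
  obtain ⟨m₀, -, hm₀⟩ := Finset.exists_min_image (Finset.range (N + 2)) q ⟨0, by simp⟩
  have hq₀ : 0 < q m₀ := by
    have := hpos ha m₀
    have := hpos hb m₀
    positivity
  refine ⟨min (q m₀) (L / 3 ^ |a - b|), lt_min hq₀ (by positivity), fun m => ?_⟩
  have hPb := hpos hb m
  rcases lt_or_ge m (N + 2) with hm | hm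
  · rw [mul_assoc, ← le_div_iff₀ (by positivity)]
    exact (min_le_left _ _).trans (hm₀ m (Finset.mem_range.2 hm))
  · exact le_trans (by gcongr; exact min_le_right _ _) (hlarge m hm)

lemma genGamma_pos {μ : ℝ} (hμ : -1 / 2 < μ) (n : ℕ) : 0 < genGamma μ n := by
  have h1 : 0 < Gamma (μ + 1 / 2) := Gamma_pos_of_pos (by linarith)
  have h0 : (0 : ℝ) ≤ ((n / 2 : ℕ) : ℝ) := Nat.cast_nonneg _
  have h2 : 0 < Gamma (((n / 2 : ℕ) : ℝ) + μ + 1 / 2) := Gamma_pos_of_pos (by linarith)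
  have h3 : 0 < Gamma (((n / 2 : ℕ) : ℝ) + μ + 3 / 2) := Gamma_pos_of_pos (by linarith)
  unfold genGamma
  split_ifs <;> positivity

lemma genGamma_two_mul_add_one {μ : ℝ} (hμ : -1 / 2 < μ) (m : ℕ) :
    genGamma μ (2 * m + 1) = (2 * m + 1 + 2 * μ) * genGamma μ (2 * m) := by
  have h0 : (0 : ℝ) ≤ m := Nat.cast_nonneg _
  have h : Gamma (m + μ + 3 / 2) = (m + μ + 1 / 2) * Gamma (m + μ + 1 / 2) := by
    rw [← Gamma_add_one (by linarith)]; ring_nf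
  have e1 : ¬ Even (2 * m + 1) := by simp
  have e2 : (2 * m + 1) / 2 = m := by omega
  have e3 : 2 * m / 2 = m := by omega
  simp only [genGamma, if_neg e1, if_pos (even_two_mul m), e2, e3, h]
  ring

lemma genGamma_two_mul_add_two {μ : ℝ} (m : ℕ) :
    genGamma μ (2 * m + 2) = (2 * m + 2) * genGamma μ (2 * m + 1) := by
  have e1 : ¬ Even (2 * m + 1) := by simp
  have e0 : Even (2 * m + 2) := by simp [Nat.even_add]
  have e2 : (2 * m + 1) / 2 = m := by omega
  have e3 : (2 * m + 2) / 2 = m + 1 := by omega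
  have e4 : ((m + 1 : ℕ) : ℝ) + μ + 1 / 2 = m + μ + 3 / 2 := by push_cast; ring
  simp only [genGamma, if_neg e1, if_pos e0, e2, e3, e4, Nat.factorial_succ]
  push_cast
  ring

lemma genGamma_two_mul {μ : ℝ} (hμ : -1 / 2 < μ) (m : ℕ) :
    genGamma μ (2 * m) =
      4 ^ m * m.factorial * ∏ j ∈ Finset.range m, (μ + 1 / 2 + j) := by
  induction m with
  | zero =>
    have h1 : 0 < Gamma (μ + 1 / 2) := Gamma_pos_of_pos (by linarith)
    simp only [genGamma, mul_zero, Even.zero, if_true, Nat.zero_div, Nat.cast_zero, zero_add,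
      pow_zero, Nat.factorial_zero, Nat.cast_one, one_mul, Finset.range_zero, Finset.prod_empty]
    exact div_self h1.ne'
  | succ m ih =>
    rw [show 2 * (m + 1) = 2 * m + 2 by ring, genGamma_two_mul_add_two,
      genGamma_two_mul_add_one hμ, ih, Finset.prod_range_succ, Nat.factorial_succ]
    push_cast
    ring

lemma factorial_two_mul_eq (m : ℕ) :
    ((2 * m).factorial : ℝ) =
      4 ^ m * m.factorial * ∏ j ∈ Finset.range m, ((1 : ℝ) / 2 + j) := by
  induction m with
  | zero => simp
  | succ m ih =>
    rw [show 2 * (m + 1) = 2 * m + 1 + 1 by ring, Nat.factorial_succ, Nat.factorial_succ,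
      Finset.prod_range_succ, Nat.factorial_succ]
    push_cast
    rw [ih]
    ring

/-- The generalized factorial grows at least like `n! (n + 1) ^ μ`. -/
lemma exists_mul_factorial_le_genGamma {μ : ℝ} (hμ : -1 / 2 < μ) :
    ∃ c, 0 < c ∧ ∀ n : ℕ, c * (n.factorial * ((n : ℝ) + 1) ^ μ) ≤ genGamma μ n := by
  obtain ⟨c, hc, h⟩ := exists_mul_prod_le_prod (a := μ + 1 / 2) (b := 1 / 2)
    (by linarith) (by norm_num)
  have hpow : ∀ n m : ℕ, m = n / 2 → ((n : ℝ) + 1) ^ μ ≤ 2 ^ |μ| * ((m : ℝ) + 1) ^ μ := by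
    intro n m hm
    refine rpow_le_rpow_abs_mul_rpow μ (by positivity) (by positivity) two_pos ?_ ?_
    · have : m ≤ n := by omega
      have : (m : ℝ) ≤ n := by exact_mod_cast this
      have : (0 : ℝ) ≤ n := Nat.cast_nonneg _
      linarith
    · have : n + 1 ≤ 2 * (m + 1) := by omega
      exact_mod_cast this
  have heven : ∀ m : ℕ, c * ((2 * m).factorial * ((m : ℝ) + 1) ^ μ) ≤ genGamma μ (2 * m) := by
    intro m
    rw [genGamma_two_mul hμ, factorial_two_mul_eq]
    have := h m
    rw [add_sub_cancel_right] at this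
    calc _ = 4 ^ m * m.factorial *
          (c * ((m : ℝ) + 1) ^ μ * ∏ j ∈ Finset.range m, ((1 : ℝ) / 2 + j)) := by ring
      _ ≤ _ := by gcongr
  have hd : 0 < min 1 (1 + 2 * μ) := lt_min one_pos (by linarith)
  refine ⟨min 1 (1 + 2 * μ) * c / 2 ^ |μ|, by positivity, fun n => ?_⟩
  rw [div_mul_eq_mul_div, div_le_iff₀ (by positivity)]
  rcases n.even_or_odd' with ⟨m, rfl | rfl⟩
  · calc _ ≤ 1 * c * ((2 * m).factorial * (2 ^ |μ| * ((m : ℝ) + 1) ^ μ)) := by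
          gcongr
          · exact min_le_left _ _
          · exact hpow _ m (by omega)
      _ = c * ((2 * m).factorial * ((m : ℝ) + 1) ^ μ) * 2 ^ |μ| := by ring
      _ ≤ _ := by gcongr; exact heven m
  · have h1 : min 1 (1 + 2 * μ) * (2 * m + 1) ≤ 2 * m + 1 + 2 * μ := by
      have : (0 : ℝ) ≤ m := Nat.cast_nonneg _
      nlinarith [min_le_left 1 (1 + 2 * μ), min_le_right 1 (1 + 2 * μ)]
    rw [genGamma_two_mul_add_one hμ, Nat.factorial_succ]
    calc _ ≤ min 1 (1 + 2 * μ) * c *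
          (((2 * m + 1 : ℕ) * (2 * m).factorial : ℕ) * (2 ^ |μ| * ((m : ℝ) + 1) ^ μ)) := by
          gcongr
          exact hpow _ m (by omega)
      _ = (min 1 (1 + 2 * μ) * (2 * m + 1)) * (c * ((2 * m).factorial * ((m : ℝ) + 1) ^ μ))
          * 2 ^ |μ| := by push_cast; ring
      _ ≤ _ := by
          gcongr
          · linarith [(by positivity : 0 ≤ min 1 (1 + 2 * μ) * (2 * (m : ℝ) + 1))]
          · exact heven m

lemma factorial_add_le (n k : ℕ) : (n + k).factorial ≤ k.factorial * n.factorial * (n + 1) ^ k := by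
  induction k with
  | zero => simp
  | succ k ih =>
    rw [← add_assoc, Nat.factorial_succ, Nat.factorial_succ, pow_succ]
    calc (n + k + 1) * (n + k).factorial
        ≤ ((k + 1) * (n + 1)) * (k.factorial * n.factorial * (n + 1) ^ k) := by
          gcongr; nlinarith
      _ = _ := by ring

lemma hasSum_pow_div_factorial (z : ℝ) : HasSum (fun n : ℕ => z ^ n / n.factorial) (exp z) := by
  rw [exp_eq_exp_ℝ]
  exact NormedSpace.expSeries_div_hasSum_exp z

/-- Bound for the exponential series weighted by positive or negative powers of `n + 1`. -/
lemma exists_tsum_weighted_le (k : ℕ) :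
    ∃ C, 0 < C ∧ ∀ z : ℝ, 0 ≤ z → ∃ S, S ≤ C * exp z ∧
      HasSum (fun n : ℕ => z ^ n / n.factorial *
        ((n + 1) / (1 + z) + ((1 + z) / (n + 1)) ^ k)) S := by
  refine ⟨1 + 2 ^ k * (1 + k.factorial), by positivity, fun z hz => ?_⟩
  have hexp := hasSum_pow_div_factorial z
  have h1 : HasSum (fun n : ℕ => z ^ n / n.factorial * ((n + 1) / (1 + z))) (exp z) := by
    have hn : HasSum (fun n : ℕ => z ^ n / n.factorial * n) (z * exp z) := by
      rw [← hasSum_nat_add_iff' 1]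
      simp only [Finset.range_one, Finset.sum_singleton, Nat.cast_zero, mul_zero, sub_zero]
      refine (hexp.mul_left z).congr_fun fun n => ?_
      rw [Nat.factorial_succ]
      push_cast
      field_simp
      ring
    have hz1 : (z * exp z + exp z) / (1 + z) = exp z := by field_simp; ring
    refine hz1 ▸ ((hn.add hexp).div_const (1 + z)).congr_fun fun n => ?_
    ring
  have htail : Summable fun n : ℕ => z ^ (n + k) / (n + k).factorial :=
    (summable_nat_add_iff k).2 hexp.summable
  have htail_le : ∑' n : ℕ, z ^ (n + k) / (n + k).factorial ≤ exp z := by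
    rw [← hexp.tsum_eq, ← hexp.summable.sum_add_tsum_nat_add k]
    exact le_add_of_nonneg_left (Finset.sum_nonneg fun i _ => by positivity)
  have hbound : ∀ n : ℕ, z ^ n / n.factorial * ((1 + z) / (n + 1)) ^ k ≤
      2 ^ k * (z ^ n / n.factorial + k.factorial * (z ^ (n + k) / (n + k).factorial)) := by
    intro n
    have hz' : (1 + z) ^ k ≤ 2 ^ k * (1 + z ^ k) := by
      rcases le_total z 1 with h | h
      · calc (1 + z) ^ k ≤ 2 ^ k := by gcongr; linarith
          _ ≤ _ := le_mul_of_one_le_right (by positivity) (by linarith [pow_nonneg hz k])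
      · calc (1 + z) ^ k ≤ (2 * z) ^ k := by gcongr; linarith
          _ = 2 ^ k * z ^ k := mul_pow _ _ _
          _ ≤ _ := by gcongr; linarith
    have hn1 : (1 : ℝ) ≤ ((n : ℝ) + 1) ^ k := one_le_pow₀ (by simp)
    have hf : ((n + k).factorial : ℝ) ≤ k.factorial * n.factorial * ((n : ℝ) + 1) ^ k := by
      exact_mod_cast factorial_add_le n k
    rw [div_pow]
    calc z ^ n / n.factorial * ((1 + z) ^ k / ((n : ℝ) + 1) ^ k)
        ≤ z ^ n / n.factorial * (2 ^ k * (1 + z ^ k) / ((n : ℝ) + 1) ^ k) := by gcongr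
      _ = 2 ^ k * (z ^ n / n.factorial * (1 / ((n : ℝ) + 1) ^ k) +
          z ^ (n + k) / (n.factorial * ((n : ℝ) + 1) ^ k)) := by
          rw [pow_add]; field_simp
      _ ≤ 2 ^ k * (z ^ n / n.factorial * 1 +
          k.factorial * (z ^ (n + k) / (n + k).factorial)) := by
          gcongr
          · exact (div_le_one (by positivity)).2 hn1
          · rw [← mul_div_assoc, div_le_div_iff₀ (by positivity) (by positivity)]
            have : 0 ≤ z ^ (n + k) := by positivity
            nlinarith
      _ = _ := by ring
  have hsum := ((hexp.summable.add (htail.mul_left (k.factorial : ℝ))).mul_left ((2 : ℝ) ^ k))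
  have h2 : Summable fun n : ℕ => z ^ n / n.factorial * ((1 + z) / (n + 1)) ^ k :=
    Summable.of_nonneg_of_le (fun n => by positivity) hbound hsum
  refine ⟨_, ?_, by simpa only [mul_add] using h1.add h2.hasSum⟩
  have h3 := h2.tsum_le_tsum hbound hsum
  rw [tsum_mul_left, hexp.summable.tsum_add (htail.mul_left _), tsum_mul_left, hexp.tsum_eq] at h3
  calc _ ≤ exp z + 2 ^ k * (exp z + k.factorial * exp z) := by
        gcongr
        exact h3.trans (by gcongr)
    _ = _ := by ring

lemma abs_genExp_le {μ : ℝ} (hμ : -1 / 2 < μ) :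
    ∃ C, 0 < C ∧ ∀ z : ℝ, |genExp μ z| ≤ C * ((1 + |z|) ^ (-μ) * exp |z|) := by
  obtain ⟨c, hc, hγ⟩ := exists_mul_factorial_le_genGamma hμ
  obtain ⟨k, hk⟩ := exists_nat_ge μ
  obtain ⟨C, hC, hS⟩ := exists_tsum_weighted_le k
  refine ⟨c⁻¹ * C, by positivity, fun z => ?_⟩
  obtain ⟨S, hSle, hsum⟩ := hS |z| (abs_nonneg z)
  have hz : 0 < 1 + |z| := by positivity
  have hpow : ∀ t : ℝ, 0 < t → t ^ (-μ) ≤ t + t⁻¹ ^ k := by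
    intro t ht
    rcases le_total 1 t with h | h
    · calc t ^ (-μ) ≤ t ^ (1 : ℝ) := rpow_le_rpow_of_exponent_le h (by linarith)
        _ = t := rpow_one t
        _ ≤ _ := by have : 0 < t⁻¹ ^ k := by positivity
                    linarith
    · calc t ^ (-μ) ≤ t ^ (-(k : ℝ)) := rpow_le_rpow_of_exponent_ge ht h (by linarith)
        _ = t⁻¹ ^ k := by rw [rpow_neg ht.le, rpow_natCast, inv_pow]
        _ ≤ _ := by linarith
  have hterm : ∀ n : ℕ, ‖z ^ n / genGamma μ n‖ ≤ c⁻¹ * (1 + |z|) ^ (-μ) *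
      (|z| ^ n / n.factorial * ((n + 1) / (1 + |z|) + ((1 + |z|) / (n + 1)) ^ k)) := by
    intro n
    have hn : (0 : ℝ) < (n : ℝ) + 1 := by positivity
    rw [norm_div, norm_pow, norm_eq_abs, norm_of_nonneg (genGamma_pos hμ n).le]
    have ht := hpow (((n : ℝ) + 1) / (1 + |z|)) (by positivity)
    rw [inv_div, div_rpow hn.le hz.le, div_le_iff₀ (by positivity)] at ht
    calc |z| ^ n / genGamma μ n
        ≤ |z| ^ n / (c * (n.factorial * ((n : ℝ) + 1) ^ μ)) := by
          gcongr
          exact hγ n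
      _ = c⁻¹ * (|z| ^ n / n.factorial * ((n : ℝ) + 1) ^ (-μ)) := by
          rw [rpow_neg hn.le]; field_simp
      _ ≤ c⁻¹ * (|z| ^ n / n.factorial *
          (((n + 1) / (1 + |z|) + ((1 + |z|) / (n + 1)) ^ k) * (1 + |z|) ^ (-μ))) := by
          gcongr
      _ = _ := by ring
  calc |genExp μ z| ≤ c⁻¹ * (1 + |z|) ^ (-μ) * S :=
        tsum_of_norm_bounded (hsum.mul_left _) hterm
    _ ≤ c⁻¹ * (1 + |z|) ^ (-μ) * (C * exp |z|) := by gcongr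
    _ = _ := by ring

/-- The model kernel with its values on `[x, x / r]` replaced by the value at `x / r`. -/
noncomputable def flatKernel (μ r x y : ℝ) : ℝ :=
  modelKernel μ r x (if x ≤ y ∧ r * y ≤ x then x / r else y)

lemma modelKernel_nonneg {μ r x y : ℝ} (hr : r ∈ Ioo (0 : ℝ) 1) (hx : 0 ≤ x) (hy : 0 ≤ y) :
    0 ≤ modelKernel μ r x y := by
  have hs := one_sub_sq_pos hr
  have hr0 := hr.1
  unfold modelKernel
  positivity

lemma flatKernel_nonneg {μ r x y : ℝ} (hr : r ∈ Ioo (0 : ℝ) 1) (hx : 0 ≤ x) (hy : 0 ≤ y) :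
    0 ≤ flatKernel μ r x y := by
  have hr0 := hr.1
  unfold flatKernel
  split_ifs
  · exact modelKernel_nonneg hr hx (by positivity)
  · exact modelKernel_nonneg hr hx hy

lemma measurable_modelKernel (μ r x : ℝ) : Measurable (modelKernel μ r x) := by
  unfold modelKernel
  fun_prop

lemma measurable_flatKernel (μ r x : ℝ) : Measurable (flatKernel μ r x) := by
  have h : MeasurableSet {y : ℝ | x ≤ y ∧ r * y ≤ x} :=
    (measurableSet_le measurable_const measurable_id).inter
      (measurableSet_le (measurable_const_mul r) measurable_const)
  exact (measurable_modelKernel μ r x).comp (Measurable.ite h measurable_const measurable_id)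

/-- Up to a constant, `flatKernel` dominates the least unimodal majorant of `modelKernel`
with mode `x`. -/
lemma modelKernel_le_mul_flatKernel (μ : ℝ) :
    ∃ C, 1 ≤ C ∧ ∀ r ∈ Ioo (0 : ℝ) 1, ∀ x y y', 0 ≤ x → 0 ≤ y → 0 ≤ y' →
      (y' ≤ y ∧ y ≤ x ∨ x ≤ y ∧ y ≤ y') →
      modelKernel μ r x y' ≤ C * flatKernel μ r x y := by
  obtain ⟨C, hC, h⟩ := modelKernel_quasi_unimodal μ
  refine ⟨C, hC, fun r hr x y y' hx hy hy' hyy => ?_⟩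
  have hr0 := hr.1
  have hrx : r * (x / r) = x := by field_simp
  unfold flatKernel
  split_ifs with hcase
  · refine h r hr x (x / r) y' hx (by positivity) hy' ?_
    rcases le_total y' (x / r) with h' | h'
    · exact Or.inl ⟨h', hrx.le⟩
    · exact Or.inr ⟨h', hrx.ge⟩
  · refine h r hr x y y' hx hy hy' ?_
    rcases hyy with ⟨h1, h2⟩ | ⟨h1, h2⟩
    · exact Or.inl ⟨h1, by nlinarith [hr.2]⟩
    · exact Or.inr ⟨h2, (not_le.1 fun h3 => hcase ⟨h1, h3⟩).le⟩

lemma exists_div_rpow_le (μ : ℝ) :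
    ∃ C, 0 < C ∧ ∀ w p u : ℝ, 0 < w → 0 < p → 0 ≤ u → p ≤ 8 * (1 + u) * max 1 w →
      w ≤ 8 * (1 + u) * p → (w / p) ^ μ ≤ C * exp (u / 2) * (1 + w ^ μ * exp (-w)) := by
  obtain ⟨C, hC, h⟩ := exists_rpow_le_mul_exp 8 |μ| (1 / 2) (by norm_num) (abs_nonneg _)
    (by norm_num)
  refine ⟨C * exp 1, by positivity, fun w p u hw hp hu hpw hwp => ?_⟩
  have hk := h u hu
  rw [one_div_mul_eq_div] at hk
  have he : 1 ≤ exp 1 := one_le_exp zero_le_one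
  have hbig : (8 * (1 + u)) ^ |μ| ≤ C * exp 1 * exp (u / 2) * (1 + w ^ μ * exp (-w)) := by
    calc (8 * (1 + u)) ^ |μ| ≤ C * exp (u / 2) := hk
      _ = C * 1 * exp (u / 2) * 1 := by ring
      _ ≤ _ := by
        gcongr
        exact le_add_of_nonneg_right (by positivity)
  have hwp' : w / p ≤ 8 * (1 + u) := (div_le_iff₀ hp).2 hwp
  rcases le_total 0 μ with hμ | hμ
  · rw [abs_of_nonneg hμ] at hbig
    exact (rpow_le_rpow (by positivity) hwp' hμ).trans hbig
  rw [abs_of_nonpos hμ] at hbig hk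
  have hinv : (w / p) ^ μ = (p / w) ^ (-μ) := by
    rw [rpow_neg (by positivity), ← inv_rpow (by positivity), inv_div]
  rcases le_total 1 w with h1 | h1
  · rw [max_eq_right h1] at hpw
    rw [hinv]
    exact (rpow_le_rpow (by positivity) ((div_le_iff₀ hw).2 hpw) (by linarith)).trans hbig
  · rw [max_eq_left h1, mul_one] at hpw
    have hpμ : p ^ (-μ) ≤ C * exp (u / 2) :=
      (rpow_le_rpow hp.le hpw (by linarith)).trans hk
    have hew : 1 ≤ exp 1 * exp (-w) := by
      rw [← exp_add]
      exact one_le_exp (by linarith)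
    calc (w / p) ^ μ = w ^ μ * p ^ (-μ) * 1 := by
          rw [div_rpow hw.le hp.le, rpow_neg hp.le, mul_one]; rfl
      _ ≤ w ^ μ * (C * exp (u / 2)) * (exp 1 * exp (-w)) := by gcongr
      _ = C * exp 1 * exp (u / 2) * (w ^ μ * exp (-w)) := by ring
      _ ≤ _ := by gcongr; linarith

lemma scaled_weight_eq {μ s p y : ℝ} (hs : 0 < s) (hp : 0 < p) (hy : 0 < y) (E : ℝ) :
    s ^ (-(μ + 1 / 2)) * p ^ (-μ) * exp E * (y ^ (2 * μ) * exp (-y ^ 2)) =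
      (√s)⁻¹ * ((y ^ 2 / s / p) ^ μ * exp (E - y ^ 2)) := by
  rw [div_rpow (by positivity) hp.le, div_rpow (by positivity) hs.le, rpow_mul hy.le,
    rpow_two, sub_eq_add_neg, exp_add, neg_add, rpow_add hs, rpow_neg hs.le, rpow_neg hs.le,
    rpow_neg hp.le, sqrt_eq_rpow]
  ring

lemma exists_scaled_weight_le (μ : ℝ) :
    ∃ C, 0 < C ∧ ∀ s p y E u : ℝ, 0 < s → 0 < p → 0 < y → 0 ≤ u →
      p ≤ 8 * (1 + u) * max 1 (y ^ 2 / s) → y ^ 2 / s ≤ 8 * (1 + u) * p → E - y ^ 2 ≤ -(u / 2) →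
      s ^ (-(μ + 1 / 2)) * p ^ (-μ) * exp E * (y ^ (2 * μ) * exp (-y ^ 2)) ≤
        C * ((√s)⁻¹ * (exp (u / 2 + (E - y ^ 2)) + (y ^ 2 / s) ^ μ * exp (-(y ^ 2 / s)))) := by
  obtain ⟨C, hC, h⟩ := exists_div_rpow_le μ
  refine ⟨C, hC, fun s p y E u hs hp hy hu h1 h2 hE => ?_⟩
  rw [scaled_weight_eq hs hp hy]
  set w := y ^ 2 / s
  have hw : 0 < w := by positivity
  have hexp : exp (u / 2 + (E - y ^ 2)) ≤ 1 := exp_le_one_iff.2 (by linarith)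
  calc (√s)⁻¹ * ((w / p) ^ μ * exp (E - y ^ 2))
      ≤ (√s)⁻¹ * (C * exp (u / 2) * (1 + w ^ μ * exp (-w)) * exp (E - y ^ 2)) := by
        gcongr
        exact h w p u hw hp hu h1 h2
    _ = C * ((√s)⁻¹ * (exp (u / 2 + (E - y ^ 2)) +
          exp (u / 2 + (E - y ^ 2)) * (w ^ μ * exp (-w)))) := by
        rw [exp_add]; ring
    _ ≤ _ := by
        gcongr C * (_ * (_ + ?_))
        exact mul_le_of_le_one_left (by positivity) hexp

lemma modelKernel_mul_density_le (μ : ℝ) :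
    ∃ C, 0 < C ∧ ∀ r ∈ Ioo (0 : ℝ) 1, ∀ x y : ℝ, 0 ≤ x → 0 < y →
      modelKernel μ r x y * (y ^ (2 * μ) * exp (-y ^ 2)) ≤
        C * ((√(1 - r ^ 2))⁻¹ * (exp (-((y - r * x) ^ 2 / (1 - r ^ 2) / 2)) +
          (y ^ 2 / (1 - r ^ 2)) ^ μ * exp (-(y ^ 2 / (1 - r ^ 2))))) := by
  obtain ⟨C, hC, h⟩ := exists_scaled_weight_le μ
  refine ⟨C, hC, fun r hr x y hx hy => ?_⟩
  have hs := one_sub_sq_pos hr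
  have hr0 := hr.1
  have hEq : (2 * x * y * r - r ^ 2 * (x ^ 2 + y ^ 2)) / (1 - r ^ 2) - y ^ 2 =
      -((y - r * x) ^ 2 / (1 - r ^ 2)) := by
    field_simp; ring
  have hu : 0 ≤ (y - r * x) ^ 2 / (1 - r ^ 2) := by positivity
  have hp : 0 ≤ 2 * x * y * r / (1 - r ^ 2) := by positivity
  have h1 : 2 * x * y * r / (1 - r ^ 2) ≤
      3 * (y ^ 2 / (1 - r ^ 2)) + (y - r * x) ^ 2 / (1 - r ^ 2) := by
    rw [← mul_div_assoc, ← add_div]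
    refine div_le_div_of_nonneg_right ?_ hs.le
    nlinarith [sq_nonneg (2 * y - r * x)]
  have h2 : y ^ 2 / (1 - r ^ 2) ≤
      2 * x * y * r / (1 - r ^ 2) + 4 * ((y - r * x) ^ 2 / (1 - r ^ 2)) := by
    rw [← mul_div_assoc, ← add_div]
    refine div_le_div_of_nonneg_right ?_ hs.le
    rcases le_total y (2 * (r * x)) with h' | h' <;> nlinarith [mul_nonneg hr0.le hx]
  unfold modelKernel
  refine (h (1 - r ^ 2) (1 + 2 * x * y * r / (1 - r ^ 2)) y _ ((y - r * x) ^ 2 / (1 - r ^ 2)) hs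
    (by positivity) hy hu ?_ ?_ (hEq.trans_le (by linarith))).trans_eq ?_
  · set w := y ^ 2 / (1 - r ^ 2)
    set u := (y - r * x) ^ 2 / (1 - r ^ 2)
    have hm1 := le_max_left 1 w
    have hm2 := le_max_right 1 w
    nlinarith [mul_nonneg hu (sub_nonneg.2 hm1)]
  · nlinarith [mul_nonneg hu hp]
  · rw [hEq]
    ring_nf

lemma modelKernel_div_mul_density_le (μ : ℝ) :
    ∃ C, 0 < C ∧ ∀ r ∈ Ioo (0 : ℝ) 1, ∀ x y : ℝ, 0 ≤ x → 0 < y → x ≤ y → r * y ≤ x →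
      modelKernel μ r x (x / r) * (y ^ (2 * μ) * exp (-y ^ 2)) ≤
        C * ((√(1 - r ^ 2))⁻¹ * (exp (-((y - x) ^ 2 / (1 - r ^ 2) / 2)) +
          (y ^ 2 / (1 - r ^ 2)) ^ μ * exp (-(y ^ 2 / (1 - r ^ 2))))) := by
  obtain ⟨C, hC, h⟩ := exists_scaled_weight_le μ
  refine ⟨C, hC, fun r hr x y hx hy hxy hyx => ?_⟩
  have hs := one_sub_sq_pos hr
  have hr0 := hr.1
  have hr1 := hr.2
  have hp_eq : 2 * x * (x / r) * r = 2 * x ^ 2 := by field_simp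
  have hE_eq : (2 * x ^ 2 - r ^ 2 * (x ^ 2 + (x / r) ^ 2)) / (1 - r ^ 2) = x ^ 2 := by
    field_simp; ring
  have hgauss : (y - x) ^ 2 / 2 + (x ^ 2 - y ^ 2) ≤ -((y - x) ^ 2 / (1 - r ^ 2) / 2) := by
    have h0 : 0 ≤ y - x := by linarith
    have h1 : (y - x) * r ≤ x * (1 - r) := by linarith
    have h2 : (y - x) ^ 2 / (1 - r ^ 2) ≤ (y - x) ^ 2 + 4 * x * (y - x) := by
      rw [div_le_iff₀ hs]
      have h3 : r * (y - x) * (y - x) ≤ x * (1 - r) * (y - x) :=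
        mul_le_mul_of_nonneg_right (by linarith) h0
      have h4 : r * (r * (y - x) * (y - x)) ≤ 1 * (x * (1 - r) * (y - x)) :=
        mul_le_mul hr1.le h3 (by positivity) zero_le_one
      have h5 : 0 ≤ x * (1 - r) * (y - x) := mul_nonneg (mul_nonneg hx (by linarith)) h0
      have h6 : 0 ≤ r * (x * (1 - r) * (y - x)) := mul_nonneg hr0.le h5
      nlinarith
    nlinarith
  have hdens : y ^ 2 ≤ 8 * (1 + (y - x) ^ 2) * (1 - r ^ 2 + 2 * x ^ 2) := by
    have h0 : 0 ≤ (y - x) ^ 2 * x ^ 2 := by positivity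
    have h0' : 0 ≤ (y - x) ^ 2 * (1 - r ^ 2) := by positivity
    rcases le_total y (2 * x) with h2 | h2
    · nlinarith
    · have hr2 : r ≤ 1 / 2 ∨ x = 0 := by
        rcases hx.eq_or_lt with h | h
        · exact Or.inr h.symm
        · left; nlinarith
      have hr3 : r ≤ 1 / 2 := by
        rcases hr2 with h | h
        · exact h
        · subst h; nlinarith
      have hs' : 3 / 4 ≤ 1 - r ^ 2 := by nlinarith
      have hyh : y ^ 2 ≤ (2 * (y - x)) ^ 2 := by gcongr; linarith
      nlinarith [mul_le_mul_of_nonneg_left hs' (sq_nonneg (y - x))]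
  unfold modelKernel
  rw [hp_eq, hE_eq]
  refine (h (1 - r ^ 2) (1 + 2 * x ^ 2 / (1 - r ^ 2)) y (x ^ 2) ((y - x) ^ 2) hs
    (by positivity) hy (by positivity) ?_ ?_ (by nlinarith)).trans ?_
  · have hxw : 2 * x ^ 2 / (1 - r ^ 2) ≤ 2 * (y ^ 2 / (1 - r ^ 2)) := by
      rw [← mul_div_assoc]
      gcongr
    set w := y ^ 2 / (1 - r ^ 2)
    have h1 := le_max_left 1 w
    have h2 := le_max_right 1 w
    have h3 : 0 ≤ (y - x) ^ 2 * max 1 w := by positivity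
    nlinarith
  · rw [div_le_iff₀ hs]
    refine hdens.trans_eq ?_
    field_simp
  · gcongr

lemma integrable_abs_rpow_mul_exp {μ : ℝ} (hμ : -1 / 2 < μ) :
    Integrable fun y : ℝ => |y| ^ (2 * μ) * exp (-y ^ 2) := by
  refine Integrable.of_integral_ne_zero ?_
  have h := integral_comp_abs (f := fun y => y ^ (2 * μ) * exp (-y ^ (2 : ℝ)))
  simp only [rpow_two, sq_abs] at h
  rw [h]
  have h2 := integral_rpow_mul_exp_neg_rpow (p := 2) (q := 2 * μ) two_pos (by linarith)
  simp only [rpow_two] at h2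
  rw [h2]
  have := Gamma_pos_of_pos (s := (2 * μ + 1) / 2) (by linarith)
  positivity

lemma isFiniteMeasure_lam {μ : ℝ} (hμ : -1 / 2 < μ) : IsFiniteMeasure (lam μ) :=
  isFiniteMeasure_withDensity_ofReal (integrable_abs_rpow_mul_exp hμ).2

/-- The integral of the flattened kernel is bounded uniformly in the parameters. -/
lemma exists_lintegral_flatKernel_le {μ : ℝ} (hμ : -1 / 2 < μ) :
    ∃ C, 0 < C ∧ ∀ r ∈ Ioo (0 : ℝ) 1, ∀ x : ℝ, 0 ≤ x →
      ∫⁻ y, ENNReal.ofReal (flatKernel μ r x |y|) ∂(lam μ) ≤ ENNReal.ofReal C := by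
  obtain ⟨C₁, hC₁, h₁⟩ := modelKernel_mul_density_le μ
  obtain ⟨C₂, hC₂, h₂⟩ := modelKernel_div_mul_density_le μ
  set Φ : ℝ → ℝ := fun v => |v| ^ (2 * μ) * exp (-v ^ 2) with hΦ
  set Ψ : ℝ → ℝ := fun v => exp (-(1 / 2) * v ^ 2) with hΨ
  have hΦi : Integrable Φ := integrable_abs_rpow_mul_exp hμ
  have hΨi : Integrable Ψ := integrable_exp_neg_mul_sq (by norm_num)
  have hΦ0 : ∀ v, 0 ≤ Φ v := fun v => by positivity
  have hΨ0 : ∀ v, 0 ≤ Ψ v := fun v => (exp_pos _).le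
  have hM : 0 ≤ (∫ v, Φ v) + 4 * ∫ v, Ψ v := by
    have := integral_nonneg (μ := volume) (f := Φ) hΦ0
    have := integral_nonneg (μ := volume) (f := Ψ) hΨ0
    positivity
  refine ⟨(C₁ + C₂) * ((∫ v, Φ v) + 4 * ∫ v, Ψ v) + 1, by positivity, fun r hr x hx => ?_⟩
  have hs := one_sub_sq_pos hr
  set σ := √(1 - r ^ 2) with hσ
  have hσ0 : 0 < σ := sqrt_pos.2 hs
  have hσ2 : σ ^ 2 = 1 - r ^ 2 := sq_sqrt hs.le
  have hdiv : ∀ a : ℝ, a ^ 2 / (1 - r ^ 2) = (a / σ) ^ 2 := fun a => by rw [div_pow, hσ2]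
  set h : ℝ → ℝ := fun y => (C₁ + C₂) * (σ⁻¹ * (Φ (y / σ) +
    (Ψ ((y - r * x) / σ) + Ψ ((y + r * x) / σ)) + (Ψ ((y - x) / σ) + Ψ ((y + x) / σ)))) with hh
  have hΦσ := hΦi.comp_div hσ0.ne'
  have hΨσ := hΨi.comp_div hσ0.ne'
  have hΨs : ∀ a, Integrable fun y => Ψ ((y - a) / σ) := fun a => hΨσ.comp_sub_right a
  have hΨa : ∀ a, Integrable fun y => Ψ ((y + a) / σ) := fun a => hΨσ.comp_add_right a
  have hΨsa : ∀ a, Integrable fun y => Ψ ((y - a) / σ) + Ψ ((y + a) / σ) :=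
    fun a => (hΨs a).add (hΨa a)
  have hΦΨ : Integrable fun y => Φ (y / σ) + (Ψ ((y - r * x) / σ) + Ψ ((y + r * x) / σ)) :=
    hΦσ.add (hΨsa _)
  have hhi : Integrable h := ((hΦΨ.add (hΨsa _)).const_mul _).const_mul _
  have hh0 : ∀ y, 0 ≤ h y := fun y => by positivity
  have hΦint : ∫ y, Φ (y / σ) = σ * ∫ v, Φ v := by
    rw [Measure.integral_comp_div, abs_of_pos hσ0, smul_eq_mul]
  have hΨint : ∫ y, Ψ (y / σ) = σ * ∫ v, Ψ v := by
    rw [Measure.integral_comp_div, abs_of_pos hσ0, smul_eq_mul]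
  have hΨsint : ∀ a, ∫ y, Ψ ((y - a) / σ) = σ * ∫ v, Ψ v := fun a => by
    rw [← hΨint]; exact integral_sub_right_eq_self (fun y => Ψ (y / σ)) a
  have hΨaint : ∀ a, ∫ y, Ψ ((y + a) / σ) = σ * ∫ v, Ψ v := fun a => by
    rw [← hΨint]; exact integral_add_right_eq_self (fun y => Ψ (y / σ)) a
  have hhint : ∫ y, h y = (C₁ + C₂) * ((∫ v, Φ v) + 4 * ∫ v, Ψ v) := by
    rw [hh, integral_const_mul, integral_const_mul,
      integral_add hΦΨ (hΨsa _), integral_add hΦσ (hΨsa _), integral_add (hΨs _) (hΨa _),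
      integral_add (hΨs _) (hΨa _), hΦint, hΨsint, hΨaint, hΨsint, hΨaint]
    field_simp
    ring
  have hgauss : ∀ y a : ℝ, exp (-((|y| - a) ^ 2 / (1 - r ^ 2) / 2)) ≤
      Ψ ((y - a) / σ) + Ψ ((y + a) / σ) := by
    intro y a
    have e : ∀ b : ℝ, exp (-(b ^ 2 / (1 - r ^ 2) / 2)) = Ψ (b / σ) := fun b => by
      rw [hdiv]; simp only [hΨ]; ring_nf
    rw [e]
    rcases abs_cases y with ⟨hy, -⟩ | ⟨hy, -⟩
    · rw [hy]; linarith [hΨ0 ((y + a) / σ)]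
    · have : Ψ ((|y| - a) / σ) = Ψ ((y + a) / σ) := by
        simp only [hΨ, hy]; ring_nf
      rw [this]; linarith [hΨ0 ((y - a) / σ)]
  have hpoint : ∀ y : ℝ, y ≠ 0 →
      |y| ^ (2 * μ) * exp (-y ^ 2) * flatKernel μ r x |y| ≤ h y := by
    intro y hy
    have hy' : 0 < |y| := abs_pos.2 hy
    have hΦy : (|y| ^ 2 / (1 - r ^ 2)) ^ μ * exp (-(|y| ^ 2 / (1 - r ^ 2))) = Φ (y / σ) := by
      rw [hdiv]
      simp only [hΦ]
      rw [abs_div, abs_of_pos hσ0, rpow_mul (by positivity), rpow_two, div_pow, div_pow, sq_abs]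
    have hσi : 0 < σ⁻¹ := inv_pos.2 hσ0
    rw [← sq_abs y, mul_comm]
    unfold flatKernel
    split_ifs with hc
    · refine (h₂ r hr x |y| hx hy' hc.1 hc.2).trans ?_
      rw [hΦy, hh]
      refine mul_le_mul (by linarith) (mul_le_mul_of_nonneg_left ?_ hσi.le) ?_ (by positivity)
      · linarith [hgauss y x, hΨ0 ((y - r * x) / σ), hΨ0 ((y + r * x) / σ)]
      · have := hΦ0 (y / σ)
        positivity
    · refine (h₁ r hr x |y| hx hy').trans ?_
      rw [hΦy, hh]
      refine mul_le_mul (by linarith) (mul_le_mul_of_nonneg_left ?_ hσi.le) ?_ (by positivity)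
      · linarith [hgauss y (r * x), hΨ0 ((y - x) / σ), hΨ0 ((y + x) / σ)]
      · have := hΦ0 (y / σ)
        positivity
  have hflat : Measurable fun y : ℝ => ENNReal.ofReal (flatKernel μ r x |y|) :=
    ((measurable_flatKernel μ r x).comp (by fun_prop)).ennreal_ofReal
  have hdens : Measurable fun y : ℝ => ENNReal.ofReal (|y| ^ (2 * μ) * exp (-y ^ 2)) := by
    fun_prop
  rw [lam, lintegral_withDensity_eq_lintegral_mul _ hdens hflat]
  calc _ ≤ ∫⁻ y, ENNReal.ofReal (h y) := by
        refine lintegral_mono_ae ?_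
        filter_upwards [compl_mem_ae_iff.2 (measure_singleton (0 : ℝ))] with y hy
        rw [Pi.mul_apply, ← ENNReal.ofReal_mul (by positivity)]
        exact ENNReal.ofReal_le_ofReal (hpoint y hy)
    _ = ENNReal.ofReal (∫ y, h y) :=
        (ofReal_integral_eq_lintegral_ofReal hhi (ae_of_all _ hh0)).symm
    _ ≤ _ := ENNReal.ofReal_le_ofReal (by rw [hhint]; linarith)

/-- The kernel is dominated by the model kernel. -/
lemma exists_abs_K_le {μ : ℝ} (hμ : -1 / 2 < μ) :
    ∃ C, 0 < C ∧ ∀ r ∈ Ioo (0 : ℝ) 1, ∀ x y : ℝ,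
      |K μ r x y| ≤ C * modelKernel μ r |x| |y| := by
  obtain ⟨C, hC, h⟩ := abs_genExp_le hμ
  have hΓ : 0 < Gamma (μ + 1 / 2) := Gamma_pos_of_pos (by linarith)
  refine ⟨(Gamma (μ + 1 / 2))⁻¹ * C, by positivity, fun r hr x y => ?_⟩
  have hs := one_sub_sq_pos hr
  have hz : |2 * x * y * r / (1 - r ^ 2)| = 2 * |x| * |y| * r / (1 - r ^ 2) := by
    rw [abs_div, abs_of_pos hs, abs_mul, abs_mul, abs_mul, abs_of_pos hr.1, abs_two]
  have hexp : (2 * |x| * |y| * r - r ^ 2 * (|x| ^ 2 + |y| ^ 2)) / (1 - r ^ 2) =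
      -(x ^ 2 + y ^ 2) * r ^ 2 / (1 - r ^ 2) + 2 * |x| * |y| * r / (1 - r ^ 2) := by
    rw [sq_abs, sq_abs]; ring
  have hz' := h (2 * x * y * r / (1 - r ^ 2))
  rw [hz] at hz'
  unfold K modelKernel
  rw [abs_mul, abs_mul, abs_of_pos (exp_pos _), abs_of_pos (by positivity), hexp, exp_add,
    rpow_neg hs.le, mul_inv]
  calc _ ≤ (Gamma (μ + 1 / 2))⁻¹ * ((1 - r ^ 2) ^ (μ + 1 / 2))⁻¹ *
        (exp (-(x ^ 2 + y ^ 2) * r ^ 2 / (1 - r ^ 2)) *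
          (C * ((1 + 2 * |x| * |y| * r / (1 - r ^ 2)) ^ (-μ) *
            exp (2 * |x| * |y| * r / (1 - r ^ 2))))) := by gcongr
    _ = _ := by ring

/-- Off the excess set of `f λ` with respect to `λ`, folded by the absolute value, the maximal
function is controlled by the level. -/
lemma exists_Tstar_le {μ : ℝ} (hμ : -1 / 2 < μ) :
    ∃ C, 0 < C ∧ ∀ f : ℝ → ℝ, Integrable f (lam μ) → ∀ c : ℝ, 0 < c → ∀ x : ℝ,
      |x| ∉ excessSet ((lam μ).map abs) (((lam μ).withDensity fun y => ‖f y‖ₑ).map abs)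
        (ENNReal.ofReal c) → Tstar μ f x ≤ C * c := by
  have := isFiniteMeasure_lam hμ
  obtain ⟨C₁, hC₁, hK⟩ := exists_abs_K_le hμ
  obtain ⟨C₂, hC₂, hmaj⟩ := modelKernel_le_mul_flatKernel μ
  obtain ⟨C₃, hC₃, hint⟩ := exists_lintegral_flatKernel_le hμ
  have hC₂' : 0 < C₂ := by linarith
  refine ⟨C₁ * C₂ * C₃, by positivity, fun f hf c hc x hx => ?_⟩
  have : Nonempty (Ioo (0 : ℝ) 1) := ⟨⟨1 / 2, by norm_num, by norm_num⟩⟩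
  refine ciSup_le fun ⟨r, hr⟩ => ?_
  set ν := (lam μ).map abs
  set G := ((lam μ).withDensity fun y => ‖f y‖ₑ).map abs
  have habs : Measurable (abs : ℝ → ℝ) := measurable_abs
  set B : ℝ → ℝ := (Ici 0).indicator (modelKernel μ r |x|) with hB
  set D : ℝ → ℝ := (Ici 0).indicator fun y => C₂ * flatKernel μ r |x| y with hD
  have hBm : Measurable B := (measurable_modelKernel μ r |x|).indicator measurableSet_Ici
  have hDm : Measurable D :=
    ((measurable_flatKernel μ r |x|).const_mul C₂).indicator measurableSet_Ici
  have hx0 := abs_nonneg x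
  have hB0 : 0 ≤ B := fun y => indicator_nonneg (fun y hy => modelKernel_nonneg hr hx0 hy) y
  have hD0 : 0 ≤ D := fun y => indicator_nonneg
    (fun y hy => mul_nonneg hC₂'.le (flatKernel_nonneg hr hx0 hy)) y
  have hBD : ∀ y y', (y' ≤ y ∧ y ≤ |x| ∨ |x| ≤ y ∧ y ≤ y') → B y' ≤ D y := by
    intro y y' h
    rcases lt_or_ge y' 0 with hy' | hy'
    · rw [hB, indicator_of_notMem (notMem_Ici.2 hy')]
      exact hD0 y
    · have hy : 0 ≤ y := by
        rcases h with h | h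
        · exact hy'.trans h.1
        · exact hx0.trans h.1
      rw [hB, hD, indicator_of_mem (mem_Ici.2 hy'), indicator_of_mem (mem_Ici.2 hy)]
      exact hmaj r hr |x| y y' hx0 hy hy' h
  have hBint : ∫⁻ y, ENNReal.ofReal (B y) ∂G = ∫⁻ y, ‖f y‖ₑ * ENNReal.ofReal (B |y|) ∂(lam μ) := by
    have hBa : Measurable fun y : ℝ => ENNReal.ofReal (B |y|) := (hBm.comp habs).ennreal_ofReal
    rw [lintegral_map hBm.ennreal_ofReal habs,
      lintegral_withDensity_eq_lintegral_mul₀ hf.1.enorm hBa.aemeasurable]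
    rfl
  have hDint : ∫⁻ y, ENNReal.ofReal (D y) ∂ν ≤ ENNReal.ofReal (C₂ * C₃) := by
    rw [lintegral_map hDm.ennreal_ofReal habs, ENNReal.ofReal_mul hC₂'.le]
    simp only [hD, indicator_of_mem (mem_Ici.2 (abs_nonneg _)), ENNReal.ofReal_mul hC₂'.le]
    rw [lintegral_const_mul' _ _ ENNReal.ofReal_ne_top]
    gcongr
    exact hint r hr |x| hx0
  have hBG : ∫⁻ y, ENNReal.ofReal (B y) ∂G ≤
      ENNReal.ofReal c * ∫⁻ y, ENNReal.ofReal (D y) ∂ν :=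
    lintegral_le_of_unimodal_majorant
      (fun J hJ hxJ => measure_le_of_notMem_excessSet (ENNReal.ofReal_pos.2 hc).ne'
        ENNReal.ofReal_ne_top hx hJ hxJ)
      ENNReal.ofReal_ne_top hB0 hD0 hBm hDm (fun y' y h h' => hBD y y' (Or.inl ⟨h, h'⟩))
      (fun y y' h h' => hBD y y' (Or.inr ⟨h, h'⟩))
  have hmain : ‖∫ y, K μ r x y * f y ∂(lam μ)‖ₑ ≤ ENNReal.ofReal (C₁ * C₂ * C₃ * c) := by
    calc _ ≤ ∫⁻ y, ‖K μ r x y * f y‖ₑ ∂(lam μ) := enorm_integral_le_lintegral_enorm _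
      _ ≤ ∫⁻ y, ENNReal.ofReal C₁ * (‖f y‖ₑ * ENNReal.ofReal (B |y|)) ∂(lam μ) := by
          refine lintegral_mono fun y => ?_
          rw [enorm_mul, mul_comm ‖f y‖ₑ, ← mul_assoc, ← ENNReal.ofReal_mul hC₁.le,
            enorm_eq_ofReal_abs, hB, indicator_of_mem (mem_Ici.2 (abs_nonneg _))]
          gcongr
          exact hK r hr x y
      _ = ENNReal.ofReal C₁ * ∫⁻ y, ENNReal.ofReal (B y) ∂G := by
          rw [lintegral_const_mul' _ _ ENNReal.ofReal_ne_top, hBint]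
      _ ≤ ENNReal.ofReal C₁ * (ENNReal.ofReal c * ENNReal.ofReal (C₂ * C₃)) := by
          gcongr
          exact hBG.trans (by gcongr)
      _ = _ := by
          rw [← ENNReal.ofReal_mul hc.le, ← ENNReal.ofReal_mul hC₁.le]
          ring_nf
  rw [enorm_eq_ofReal_abs] at hmain
  exact (ENNReal.ofReal_le_ofReal_iff (by positivity)).1 hmain

/-- The maximal function T*_μ is of weak type (1,1) with respect to λ. -/
theorem Tstar_weak_type_one_one (μ : ℝ) (hμ : -1 / 2 < μ) :
    ∃ C : ℝ, 0 < C ∧ ∀ f : ℝ → ℝ, Integrable f (lam μ) → ∀ η : ℝ, 0 < η →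
      lam μ {x : ℝ | η < Tstar μ f x} ≤
        ENNReal.ofReal (C / η * ∫ y, |f y| ∂(lam μ)) := by
  have := isFiniteMeasure_lam hμ
  obtain ⟨C, hC, h⟩ := exists_Tstar_le hμ
  refine ⟨2 * C, by positivity, fun f hf η hη => ?_⟩
  have hc : 0 < η / C := by positivity
  set ν := (lam μ).map abs
  set G := ((lam μ).withDensity fun y => ‖f y‖ₑ).map abs
  set U := excessSet ν G (ENNReal.ofReal (η / C))
  have hU : MeasurableSet U := (isOpen_excessSet _ _ _).measurableSet
  have hsub : {x : ℝ | η < Tstar μ f x} ⊆ abs ⁻¹' U := by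
    intro x hx
    by_contra hxU
    have := h f hf (η / C) hc x hxU
    rw [mul_div_cancel₀ η hC.ne'] at this
    exact absurd hx (not_lt.2 this)
  have hG : G univ = ENNReal.ofReal (∫ y, |f y| ∂(lam μ)) := by
    rw [Measure.map_apply measurable_abs MeasurableSet.univ, preimage_univ,
      withDensity_apply _ MeasurableSet.univ, setLIntegral_univ,
      ← ofReal_integral_norm_eq_lintegral_enorm hf]
    rfl
  have hweak := mul_measure_excessSet_le ν G (ENNReal.ofReal (η / C))
  calc lam μ {x : ℝ | η < Tstar μ f x} ≤ lam μ (abs ⁻¹' U) := measure_mono hsub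
    _ = ν U := (Measure.map_apply measurable_abs hU).symm
    _ ≤ 2 * G univ / ENNReal.ofReal (η / C) := by
        rw [ENNReal.le_div_iff_mul_le (Or.inl (ENNReal.ofReal_pos.2 hc).ne')
          (Or.inl ENNReal.ofReal_ne_top), mul_comm]
        exact hweak
    _ = ENNReal.ofReal (2 * C / η * ∫ y, |f y| ∂(lam μ)) := by
        rw [hG, ← ENNReal.ofReal_ofNat 2, ← ENNReal.ofReal_mul zero_le_two,
          ← ENNReal.ofReal_div_of_pos hc]
        congr 1
        field_simp
end

section
/- There exists a constant C > 0 such that for every η > 0, λ({x ∈ ℝ : h(x) > η}) ≤ C/η, where h(x) = max(1/|x|, |x|) · e^{x²}/|x|^{2μ}. -/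
open MeasureTheory Real Set

/-- h(x) = max(1/|x|, |x|) · e^{x²} · |x|^{-2μ}. -/
noncomputable def hFn (μ : ℝ) (x : ℝ) : ℝ :=
  max (1 / |x|) |x| * Real.exp (x ^ 2) * |x| ^ (-(2 * μ))

/-- If `w ≤ c |u'|` on `S`, where `u` is injective with values in `[0, d]`, then
`∫ w` over `S` is at most `c * d`, by the change of variables `y = u x`. -/
lemma setLIntegral_le_of_le_abs_deriv {S : Set ℝ} (hS : MeasurableSet S) {w u u' : ℝ → ℝ}
    {c d : ℝ} (hc : 0 ≤ c) (hu : ∀ x ∈ S, HasDerivAt u (u' x) x) (hinj : InjOn u S)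
    (hmaps : MapsTo u S (Icc 0 d)) (hw : ∀ x ∈ S, w x ≤ c * |u' x|) :
    ∫⁻ x in S, ENNReal.ofReal (w x) ≤ ENNReal.ofReal (c * d) := by
  calc ∫⁻ x in S, ENNReal.ofReal (w x)
      ≤ ∫⁻ x in S, ENNReal.ofReal c * (ENNReal.ofReal |u' x| * 1) := by
        refine setLIntegral_mono' hS fun x hx => ?_
        rw [mul_one, ← ENNReal.ofReal_mul hc]
        exact ENNReal.ofReal_le_ofReal (hw x hx)
    _ = ENNReal.ofReal c * volume (u '' S) := by
        rw [lintegral_const_mul' _ _ ENNReal.ofReal_ne_top,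
          ← lintegral_image_eq_lintegral_abs_deriv_mul hS
            (fun x hx => (hu x hx).hasDerivWithinAt) hinj (fun _ => 1), setLIntegral_one]
    _ ≤ ENNReal.ofReal c * ENNReal.ofReal d := by
        gcongr
        exact (measure_mono hmaps.image_subset).trans_eq (by rw [Real.volume_Icc, sub_zero])
    _ = ENNReal.ofReal (c * d) := (ENNReal.ofReal_mul hc).symm

lemma measurable_hFn (μ : ℝ) : Measurable (hFn μ) := by
  unfold hFn
  fun_prop

lemma hFn_neg (μ x : ℝ) : hFn μ (-x) = hFn μ x := by
  simp [hFn]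

lemma lam_preimage_neg (μ : ℝ) {S : Set ℝ} (hS : MeasurableSet S) :
    lam μ (Neg.neg ⁻¹' S) = lam μ S := by
  rw [lam, withDensity_apply _ hS, withDensity_apply _ (measurable_neg hS),
    ← (Measure.measurePreserving_neg (volume : Measure ℝ)).setLIntegral_comp_preimage_emb
      (MeasurableEquiv.neg ℝ).measurableEmbedding]
  simp

lemma lam_Ioc_zero_one_le {μ η : ℝ} (hμ : -1 / 2 < μ) (hη : 0 < η) :
    lam μ (Ioc 0 1 ∩ {x | η < hFn μ x}) ≤
      ENNReal.ofReal ((1 + 2 * μ)⁻¹ * (Real.exp 1 / η)) := by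
  have ha : 0 < 1 + 2 * μ := by linarith
  have hS : MeasurableSet (Ioc 0 1 ∩ {x | η < hFn μ x}) :=
    measurableSet_Ioc.inter (measurableSet_lt measurable_const (measurable_hFn μ))
  rw [lam, withDensity_apply _ hS]
  refine setLIntegral_le_of_le_abs_deriv hS (u := fun x => x ^ (1 + 2 * μ))
    (u' := fun x => (1 + 2 * μ) * x ^ (1 + 2 * μ - 1)) (by positivity) ?_ ?_ ?_ ?_
  · rintro x ⟨⟨hx, -⟩, -⟩
    exact Real.hasDerivAt_rpow_const (Or.inl hx.ne')
  · exact (Real.rpow_left_injOn ha.ne').mono fun x hx => hx.1.1.le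
  · rintro x ⟨⟨hx, hx1⟩, hxη⟩
    refine ⟨by positivity, ?_⟩
    have hpow : hFn μ x = Real.exp (x ^ 2) / x ^ (1 + 2 * μ) := by
      rw [hFn, abs_of_pos hx, max_eq_left (hx1.trans (by rwa [le_div_iff₀ hx, one_mul])),
        Real.rpow_add hx, Real.rpow_neg hx.le, Real.rpow_one]
      field_simp
    have hexp : Real.exp (x ^ 2) ≤ Real.exp 1 := Real.exp_le_exp.2 (by nlinarith)
    rw [mem_ofPred_eq, hpow, lt_div_iff₀ (by positivity)] at hxη
    rw [le_div_iff₀ hη]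
    linarith
  · rintro x ⟨⟨hx, -⟩, -⟩
    have hexp : Real.exp (-x ^ 2) ≤ 1 := Real.exp_le_one_iff.2 (by nlinarith)
    rw [abs_of_pos hx, abs_of_pos (by positivity), inv_mul_cancel_left₀ ha.ne',
      add_sub_cancel_left]
    exact mul_le_of_le_one_right (by positivity) hexp

lemma hFn_of_one_le (μ : ℝ) {x : ℝ} (hx : 1 ≤ x) :
    hFn μ x = x / (x ^ (2 * μ) * Real.exp (-x ^ 2)) := by
  have hx0 : 0 < x := by linarith
  rw [hFn, abs_of_pos hx0, max_eq_right (((div_le_one hx0).2 hx).trans hx),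
    Real.rpow_neg hx0.le, Real.exp_neg]
  field_simp

lemma lam_Icc_one_le (μ : ℝ) {R η : ℝ} (hR : 1 ≤ R) (hη : 0 < η) :
    lam μ (Icc 1 R ∩ {x | η < hFn μ x}) ≤ ENNReal.ofReal (R * (R / η)) := by
  have hS : MeasurableSet (Icc 1 R ∩ {x | η < hFn μ x}) :=
    measurableSet_Icc.inter (measurableSet_lt measurable_const (measurable_hFn μ))
  rw [lam, withDensity_apply _ hS]
  refine setLIntegral_le_of_le_abs_deriv hS (u := fun x => x / η) (u' := fun x => 1 / η)
    (by positivity) (fun x _ => (hasDerivAt_id x).div_const η) ?_ ?_ ?_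
  · intro x _ y _ hxy
    exact (div_left_inj' hη.ne').1 hxy
  · rintro x ⟨⟨hx, hxR⟩, -⟩
    exact ⟨by positivity, div_le_div_of_nonneg_right hxR hη.le⟩
  · rintro x ⟨⟨hx, hxR⟩, hxη⟩
    have hx0 : 0 < x := by linarith
    rw [mem_ofPred_eq, hFn_of_one_le μ hx, lt_div_iff₀ (by positivity)] at hxη
    rw [abs_of_pos hx0, abs_of_pos (by positivity), mul_one_div, le_div_iff₀ hη]
    linarith

lemma lam_Ioi_le (μ : ℝ) {R η : ℝ} (hR : 1 + |2 * μ - 1| ≤ R) (hη : 0 < η) :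
    lam μ (Ioi R ∩ {x | η < hFn μ x}) ≤ ENNReal.ofReal (1 * (1 / η)) := by
  have hS : MeasurableSet (Ioi R ∩ {x | η < hFn μ x}) :=
    measurableSet_Ioi.inter (measurableSet_lt measurable_const (measurable_hFn μ))
  have hR1 : 1 ≤ R := by linarith [abs_nonneg (2 * μ - 1)]
  have hderiv : ∀ x ∈ Ioi R, HasDerivAt (fun x => x ^ (2 * μ - 1) * Real.exp (-x ^ 2))
      (-((2 * x ^ 2 - (2 * μ - 1)) * (x ^ (2 * μ - 2) * Real.exp (-x ^ 2)))) x := by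
    intro x hx
    have hx0 : 0 < x := by linarith [mem_Ioi.1 hx]
    refine ((Real.hasDerivAt_rpow_const (p := 2 * μ - 1) (Or.inl hx0.ne')).fun_mul
      (hasDerivAt_pow 2 x).fun_neg.exp).congr_deriv ?_
    rw [show 2 * μ - 1 - 1 = 2 * μ - 2 by ring, show 2 * μ - 1 = 2 * μ - 2 + 1 by ring,
      Real.rpow_add_one hx0.ne']
    simp
    ring
  have hge : ∀ x ∈ Ioi R, x ^ 2 ≤ 2 * x ^ 2 - (2 * μ - 1) := by
    intro x hx
    nlinarith [mem_Ioi.1 hx, le_abs_self (2 * μ - 1)]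
  have hanti : StrictAntiOn (fun x => x ^ (2 * μ - 1) * Real.exp (-x ^ 2)) (Ioi R) := by
    refine strictAntiOn_of_deriv_neg (convex_Ioi R)
      (fun x hx => (hderiv x hx).continuousAt.continuousWithinAt) fun x hx => ?_
    rw [interior_Ioi] at hx
    have hx0 : 0 < x := by linarith [mem_Ioi.1 hx]
    rw [(hderiv x hx).deriv, neg_lt_zero]
    exact mul_pos (lt_of_lt_of_le (by positivity) (hge x hx)) (by positivity)
  rw [lam, withDensity_apply _ hS]
  refine setLIntegral_le_of_le_abs_deriv hS zero_le_one (fun x hx => hderiv x hx.1)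
    (hanti.injOn.mono inter_subset_left) ?_ ?_
  · rintro x ⟨hx, hxη⟩
    have hx0 : 0 < x := by linarith [mem_Ioi.1 hx]
    refine ⟨by positivity, ?_⟩
    rw [mem_ofPred_eq, hFn_of_one_le μ (by linarith [mem_Ioi.1 hx]),
      lt_div_iff₀ (by positivity)] at hxη
    beta_reduce
    rw [Real.rpow_sub_one hx0.ne', le_div_iff₀ hη, div_mul_eq_mul_div, div_mul_eq_mul_div,
      div_le_one hx0]
    linarith
  · rintro x ⟨hx, -⟩
    have hx0 : 0 < x := by linarith [mem_Ioi.1 hx]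
    have hpow : x ^ (2 * μ) = x ^ 2 * x ^ (2 * μ - 2) := by
      rw [← Real.rpow_natCast, ← Real.rpow_add hx0]
      norm_num
    rw [abs_of_pos hx0, one_mul, abs_neg, hpow, mul_assoc]
    exact (mul_le_mul_of_nonneg_right (hge x hx) (by positivity)).trans (le_abs_self _)

/-- The distribution function of h with respect to λ is bounded by C/η. -/
theorem hFn_distribution (μ : ℝ) (hμ : -1 / 2 < μ) :
    ∃ C : ℝ, 0 < C ∧ ∀ η : ℝ, 0 < η →
      lam μ {x : ℝ | x ≠ 0 ∧ η < hFn μ x} ≤ ENNReal.ofReal (C / η) := by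
  have ha : 0 < 1 + 2 * μ := by linarith
  set R : ℝ := 1 + |2 * μ - 1| with hRdef
  have hR : 1 ≤ R := by linarith [abs_nonneg (2 * μ - 1)]
  refine ⟨2 * ((1 + 2 * μ)⁻¹ * Real.exp 1 + R * R + 1), by positivity, fun η hη => ?_⟩
  set T : Set ℝ := Ioi 0 ∩ {x | η < hFn μ x}
  have hT : MeasurableSet T :=
    measurableSet_Ioi.inter (measurableSet_lt measurable_const (measurable_hFn μ))
  have hsub : {x : ℝ | x ≠ 0 ∧ η < hFn μ x} ⊆ T ∪ Neg.neg ⁻¹' T := by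
    rintro x ⟨hx, hxη⟩
    rcases hx.lt_or_gt with h | h
    · exact Or.inr ⟨neg_pos.2 h, by rwa [mem_ofPred_eq, hFn_neg]⟩
    · exact Or.inl ⟨h, hxη⟩
  have hcover : T ⊆ (Ioc 0 1 ∩ {x | η < hFn μ x}) ∪ (Icc 1 R ∩ {x | η < hFn μ x}) ∪
      (Ioi R ∩ {x | η < hFn μ x}) := by
    rintro x ⟨hx, hxη⟩
    rcases le_total x 1 with h | h
    · exact Or.inl (Or.inl ⟨⟨hx, h⟩, hxη⟩)
    · rcases le_or_gt x R with h' | h'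
      · exact Or.inl (Or.inr ⟨⟨h, h'⟩, hxη⟩)
      · exact Or.inr ⟨h', hxη⟩
  have hbound : lam μ T ≤ ENNReal.ofReal
      ((1 + 2 * μ)⁻¹ * (Real.exp 1 / η) + R * (R / η) + 1 * (1 / η)) := by
    rw [ENNReal.ofReal_add (by positivity) (by positivity),
      ENNReal.ofReal_add (by positivity) (by positivity)]
    refine (measure_mono hcover).trans <| (measure_union_le _ _).trans <| add_le_add
      ((measure_union_le _ _).trans <| add_le_add ?_ ?_) ?_
    · exact lam_Ioc_zero_one_le hμ hη
    · exact lam_Icc_one_le μ hR hη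
    · exact lam_Ioi_le μ hRdef.ge hη
  calc lam μ {x : ℝ | x ≠ 0 ∧ η < hFn μ x}
      ≤ lam μ T + lam μ (Neg.neg ⁻¹' T) := (measure_mono hsub).trans (measure_union_le _ _)
    _ ≤ _ := by
        rw [lam_preimage_neg μ hT]
        refine (add_le_add hbound hbound).trans_eq ?_
        rw [← ENNReal.ofReal_add (by positivity) (by positivity)]
        congr 1
        ring
end

section
/- There exists a constant C > 0 such that for every x > 0, every 0 < r < 1, and every nonnegative f ∈ L¹(λ), e^{x²} (1-r²)^{-(μ+1/2)} ∫_0^{x/(2r)} e^{-(x-ry)²/(1-r²)} (1 + 2xyr/(1-r²))^{-μ} f(y) dλ(y) ≤ C (e^{x²}/x^{2μ+1}) ∫_ℝ f dλ. -/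
open MeasureTheory Real Set

/-- A power times a linear factor is dominated by `exp (u / 4)`, uniformly in `u ≥ 0`. -/
theorem exists_rpow_mul_exp_le {a : ℝ} (ha : 0 ≤ a) :
    ∃ C : ℝ, 0 < C ∧ ∀ u : ℝ, 0 ≤ u → u ^ a * (Real.exp (-(u / 4)) * (1 + u)) ≤ C := by
  set n := ⌈a⌉₊
  refine ⟨4 ^ (n + 1) * (n + 1).factorial * Real.exp (1 / 4), by positivity, fun u hu => ?_⟩
  have h_pow : u ^ a ≤ (1 + u) ^ n := calc
    u ^ a ≤ (1 + u) ^ a := Real.rpow_le_rpow hu (by linarith) ha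
    _ ≤ (1 + u) ^ (n : ℝ) := Real.rpow_le_rpow_of_exponent_le (by linarith) (Nat.le_ceil a)
    _ = (1 + u) ^ n := Real.rpow_natCast _ _
  have h_exp := Real.pow_div_factorial_le_exp ((1 + u) / 4) (by positivity) (n + 1)
  rw [div_pow, div_div, div_le_iff₀ (by positivity)] at h_exp
  calc u ^ a * (Real.exp (-(u / 4)) * (1 + u))
      ≤ (1 + u) ^ n * (Real.exp (-(u / 4)) * (1 + u)) := by gcongr
    _ = (1 + u) ^ (n + 1) * Real.exp (-(u / 4)) := by ring
    _ ≤ Real.exp ((1 + u) / 4) * (4 ^ (n + 1) * (n + 1).factorial) * Real.exp (-(u / 4)) := by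
        gcongr
    _ = 4 ^ (n + 1) * (n + 1).factorial * (Real.exp ((1 + u) / 4) * Real.exp (-(u / 4))) := by
        ring
    _ = 4 ^ (n + 1) * (n + 1).factorial * Real.exp (1 / 4) := by
        rw [← Real.exp_add]; ring_nf

/-- Pointwise bound for the kernel on the region `0 ≤ y ≤ x / (2 r)`. -/
theorem near_kernel_le {μ x r y : ℝ} (hμ : -1 / 2 < μ) (hx : 0 < x) (hr : 0 < r) (hr1 : r < 1)
    (hy : 0 ≤ y) (hyx : y ≤ x / (2 * r)) :
    Real.exp (-(x - r * y) ^ 2 / (1 - r ^ 2)) * (1 + 2 * x * y * r / (1 - r ^ 2)) ^ (-μ) ≤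
      Real.exp (-(x ^ 2 / (1 - r ^ 2) / 4)) * (1 + x ^ 2 / (1 - r ^ 2)) := by
  have hs : 0 < 1 - r ^ 2 := by nlinarith
  have hry : 2 * (r * y) ≤ x := by
    rw [le_div_iff₀ (by positivity)] at hyx
    linarith
  have h_exp : -(x - r * y) ^ 2 / (1 - r ^ 2) ≤ -(x ^ 2 / (1 - r ^ 2) / 4) := by
    rw [div_div, mul_comm (1 - r ^ 2), ← div_div, ← neg_div]
    gcongr
    nlinarith
  have h_one : 1 ≤ 1 + 2 * x * y * r / (1 - r ^ 2) := le_add_of_nonneg_right (by positivity)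
  have h_rpow : (1 + 2 * x * y * r / (1 - r ^ 2)) ^ (-μ) ≤ 1 + x ^ 2 / (1 - r ^ 2) := calc
    _ ≤ (1 + 2 * x * y * r / (1 - r ^ 2)) ^ (1 : ℝ) :=
        Real.rpow_le_rpow_of_exponent_le h_one (by linarith)
    _ = 1 + 2 * x * y * r / (1 - r ^ 2) := Real.rpow_one _
    _ ≤ 1 + x ^ 2 / (1 - r ^ 2) := by
        gcongr
        nlinarith
  gcongr

/-- Bound for the near part of the kernel integral (the piece K_{1,r}). -/
theorem K1_bound (μ : ℝ) (hμ : -1 / 2 < μ) :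
    ∃ C : ℝ, 0 < C ∧ ∀ x : ℝ, 0 < x → ∀ r : ℝ, 0 < r → r < 1 →
      ∀ f : ℝ → ℝ, Integrable f (lam μ) → (∀ y, 0 ≤ f y) →
        Real.exp (x ^ 2) * ((1 - r ^ 2) ^ (μ + 1 / 2))⁻¹ *
            ∫ y in Set.Ioc (0 : ℝ) (x / (2 * r)),
              Real.exp (-(x - r * y) ^ 2 / (1 - r ^ 2)) *
                (1 + 2 * x * y * r / (1 - r ^ 2)) ^ (-μ) * f y ∂(lam μ) ≤
          C * (Real.exp (x ^ 2) / x ^ (2 * μ + 1)) * ∫ y, f y ∂(lam μ) := by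
  obtain ⟨C, hC, hbound⟩ := exists_rpow_mul_exp_le (a := μ + 1 / 2) (by linarith)
  refine ⟨C, hC, fun x hx r hr hr1 f hf hf0 => ?_⟩
  have hs : 0 < 1 - r ^ 2 := by nlinarith
  set u := x ^ 2 / (1 - r ^ 2) with hu
  have hu0 : 0 ≤ u := by positivity
  set K := Real.exp (-(u / 4)) * (1 + u)
  have h_int : ∫ y in Set.Ioc (0 : ℝ) (x / (2 * r)),
      Real.exp (-(x - r * y) ^ 2 / (1 - r ^ 2)) *
        (1 + 2 * x * y * r / (1 - r ^ 2)) ^ (-μ) * f y ∂(lam μ) ≤ K * ∫ y, f y ∂(lam μ) := calc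
    _ ≤ ∫ y in Set.Ioc (0 : ℝ) (x / (2 * r)), K * f y ∂(lam μ) := by
        refine integral_mono_of_nonneg ?_ (hf.integrableOn.const_mul K) ?_ <;>
          filter_upwards [ae_restrict_mem measurableSet_Ioc] with y hy
        · have hy0 := hy.1
          have hfy := hf0 y
          simp only [Pi.zero_apply]
          positivity
        · exact mul_le_mul_of_nonneg_right (near_kernel_le hμ hx hr hr1 hy.1.le hy.2) (hf0 y)
    _ = K * ∫ y in Set.Ioc (0 : ℝ) (x / (2 * r)), f y ∂(lam μ) := integral_const_mul _ _
    _ ≤ K * ∫ y, f y ∂(lam μ) :=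
        mul_le_mul_of_nonneg_left
          (setIntegral_le_integral hf (Filter.Eventually.of_forall hf0)) (by positivity)
  have h_pow : u ^ (μ + 1 / 2) = x ^ (2 * μ + 1) * ((1 - r ^ 2) ^ (μ + 1 / 2))⁻¹ := by
    rw [hu, Real.div_rpow (by positivity) hs.le, ← Real.rpow_natCast x 2, ← Real.rpow_mul hx.le,
      div_eq_mul_inv]
    congr 2
    push_cast
    ring
  have hxp : 0 < x ^ (2 * μ + 1) := by positivity
  have h_const : ((1 - r ^ 2) ^ (μ + 1 / 2))⁻¹ * K ≤ C / x ^ (2 * μ + 1) := by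
    rw [le_div_iff₀ hxp]
    calc _ = u ^ (μ + 1 / 2) * K := by rw [h_pow]; ring
      _ ≤ C := hbound u hu0
  have hI : 0 ≤ ∫ y, f y ∂(lam μ) := integral_nonneg hf0
  calc _ ≤ Real.exp (x ^ 2) * ((1 - r ^ 2) ^ (μ + 1 / 2))⁻¹ * (K * ∫ y, f y ∂(lam μ)) := by
        gcongr
    _ = Real.exp (x ^ 2) * (((1 - r ^ 2) ^ (μ + 1 / 2))⁻¹ * K) * ∫ y, f y ∂(lam μ) := by ring
    _ ≤ Real.exp (x ^ 2) * (C / x ^ (2 * μ + 1)) * ∫ y, f y ∂(lam μ) := by gcongr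
    _ = C * (Real.exp (x ^ 2) / x ^ (2 * μ + 1)) * ∫ y, f y ∂(lam μ) := by ring
end

section
/- There exists a constant C > 0 such that for every x > 0, every 0 < r < 1, and every y with y > 4x/r, (1-r²)^{-(μ+1/2)} e^{-(x-ry)²/(1-r²)} (1 + 2rxy/(1-r²))^{-μ} ≤ C / x^{2μ+1}. -/
open MeasureTheory Real Set

/-- A real power of `1 + v` grows at most like `exp (v / 2)`. -/
lemma one_add_rpow_le_mul_exp_half {p v : ℝ} (hp : 0 < p) (hv : 0 ≤ v) :
    (1 + v) ^ p ≤ (2 * p) ^ p * Real.exp (1 / 2) * Real.exp (v / 2) := by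
  have hle : 1 + v ≤ 2 * p * Real.exp ((1 + v) / (2 * p)) := by
    have h := Real.add_one_le_exp ((1 + v) / (2 * p))
    calc 1 + v = 2 * p * ((1 + v) / (2 * p)) := by field_simp
      _ ≤ _ := by gcongr; linarith
  calc (1 + v) ^ p ≤ (2 * p * Real.exp ((1 + v) / (2 * p))) ^ p :=
        Real.rpow_le_rpow (by linarith) hle hp.le
    _ = (2 * p) ^ p * Real.exp (1 / 2) * Real.exp (v / 2) := by
        rw [Real.mul_rpow (by positivity) (Real.exp_pos _).le, ← Real.exp_mul, mul_assoc,
          ← Real.exp_add]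
        congr 2
        field_simp

/-- Pointwise bound for the far part of the kernel (y > 4x/r). -/
theorem K3_pointwise_bound (μ : ℝ) (hμ : -1 / 2 < μ) :
    ∃ C : ℝ, 0 < C ∧ ∀ x : ℝ, 0 < x → ∀ r : ℝ, 0 < r → r < 1 →
      ∀ y : ℝ, 4 * x / r < y →
        ((1 - r ^ 2) ^ (μ + 1 / 2))⁻¹ * Real.exp (-(x - r * y) ^ 2 / (1 - r ^ 2)) *
            (1 + 2 * r * x * y / (1 - r ^ 2)) ^ (-μ) ≤
          C / x ^ (2 * μ + 1) := by
  have hp : 0 < μ + 1 / 2 + 1 := by linarith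
  refine ⟨(2 * (μ + 1 / 2 + 1)) ^ (μ + 1 / 2 + 1) * Real.exp (1 / 2), by positivity, ?_⟩
  intro x hx r hr hr1 y hy
  have hs : 0 < 1 - r ^ 2 := by nlinarith
  have hz : 4 * x < r * y := by rwa [div_lt_iff₀ hr, mul_comm y r] at hy
  rw [show 2 * r * x * y = 2 * x * (r * y) by ring]
  generalize 1 - r ^ 2 = s at hs ⊢
  generalize r * y = z at hz ⊢
  have hz0 : 0 < z := by linarith
  set v := z ^ 2 / s with hv
  have hv0 : 0 < v := by positivity
  have hw : 1 ≤ 1 + 2 * x * z / s := le_add_of_nonneg_right (by positivity)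
  have hexp : Real.exp (-(x - z) ^ 2 / s) ≤ Real.exp (-(v / 2)) := by
    rw [Real.exp_le_exp, hv, div_div, mul_comm s 2, ← div_div, ← neg_div]
    gcongr
    nlinarith
  have hpow : (1 + 2 * x * z / s) ^ (-μ) ≤ 1 + v := by
    calc (1 + 2 * x * z / s) ^ (-μ) ≤ (1 + 2 * x * z / s) ^ (1 : ℝ) :=
          Real.rpow_le_rpow_of_exponent_le hw (by linarith)
      _ ≤ 1 + v := by
          rw [Real.rpow_one, hv]
          gcongr
          nlinarith
  have hratio : x ^ (2 * μ + 1) * (s ^ (μ + 1 / 2))⁻¹ ≤ (1 + v) ^ (μ + 1 / 2) := by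
    have hx2 : x ^ (2 * μ + 1) = (x ^ 2) ^ (μ + 1 / 2) := by
      rw [← Real.rpow_natCast, ← Real.rpow_mul hx.le]
      congr 1
      push_cast
      ring
    rw [hx2, ← div_eq_mul_inv, ← Real.div_rpow (by positivity) hs.le]
    apply Real.rpow_le_rpow (by positivity) _ (by linarith)
    have : x ^ 2 / s ≤ v := by
      rw [hv]
      gcongr
      linarith
    linarith
  rw [le_div_iff₀ (by positivity)]
  calc (s ^ (μ + 1 / 2))⁻¹ * Real.exp (-(x - z) ^ 2 / s) * (1 + 2 * x * z / s) ^ (-μ) *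
        x ^ (2 * μ + 1)
      = x ^ (2 * μ + 1) * (s ^ (μ + 1 / 2))⁻¹ * (1 + 2 * x * z / s) ^ (-μ) *
        Real.exp (-(x - z) ^ 2 / s) := by ring
    _ ≤ (1 + v) ^ (μ + 1 / 2) * (1 + v) * Real.exp (-(v / 2)) := by gcongr
    _ = (1 + v) ^ (μ + 1 / 2 + 1) * Real.exp (-(v / 2)) := by
        rw [Real.rpow_add_one (by positivity)]
    _ ≤ (2 * (μ + 1 / 2 + 1)) ^ (μ + 1 / 2 + 1) * Real.exp (1 / 2) * Real.exp (v / 2) *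
        Real.exp (-(v / 2)) := by
        gcongr
        exact one_add_rpow_le_mul_exp_half hp hv0.le
    _ = (2 * (μ + 1 / 2 + 1)) ^ (μ + 1 / 2 + 1) * Real.exp (1 / 2) := by
        rw [mul_assoc _ (Real.exp (v / 2)), ← Real.exp_add, add_neg_cancel, Real.exp_zero, mul_one]
end

section
/- There exists a constant C > 0 such that for every x > 0, every 0 < r < 1, and every y with x/(2r) ≤ y ≤ 4x/r, (1-r²)^{-(μ+1/2)} (1 + 2rxy/(1-r²))^{-μ} ≤ C (1/x^{2μ+1} + x^{-2μ}/(1-r²)^{1/2}). -/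
open MeasureTheory Real Set

/-- The kernel factor in terms of `s = 1 - r ^ 2` and `t = 2 * r * x * y`. -/
lemma inv_rpow_mul_one_add_div_rpow {s t : ℝ} (μ : ℝ) (hs : 0 < s) (ht : 0 ≤ t) :
    (s ^ (μ + 1 / 2))⁻¹ * (1 + t / s) ^ (-μ) = (s + t) ^ (-μ) / s ^ ((1 : ℝ) / 2) := by
  have h : 1 + t / s = (s + t) / s := by field_simp
  have hp : 0 < s ^ μ := rpow_pos_of_pos hs _
  have hq : 0 < s ^ ((1 : ℝ) / 2) := rpow_pos_of_pos hs _
  rw [h, div_rpow (by positivity) hs.le, rpow_add hs, rpow_neg hs.le]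
  field_simp

lemma nine_mul_rpow_neg_le {a μ : ℝ} (ha : 0 ≤ a) (hμ : -1 / 2 < μ) :
    (9 * a) ^ (-μ) ≤ 9 * a ^ (-μ) := by
  rw [mul_rpow (by norm_num) ha]
  gcongr
  calc (9 : ℝ) ^ (-μ) ≤ 9 ^ (1 : ℝ) :=
        rpow_le_rpow_of_exponent_le (by norm_num) (by linarith)
    _ = 9 := rpow_one 9

/-- The kernel bound in the variables `s = 1 - r ^ 2` and `t = 2 * r * x * y`. -/
lemma add_rpow_neg_div_rpow_half_le {μ x s t : ℝ} (hμ : -1 / 2 < μ) (hx : 0 < x) (hs : 0 < s)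
    (hxt : x ^ 2 ≤ t) (htx : t ≤ 8 * x ^ 2) :
    (s + t) ^ (-μ) / s ^ ((1 : ℝ) / 2) ≤
      9 * (1 / x ^ (2 * μ + 1) + x ^ (-(2 * μ)) / s ^ ((1 : ℝ) / 2)) := by
  have hx2 : 0 < x ^ 2 := by positivity
  have hA : 0 < 1 / x ^ (2 * μ + 1) := by positivity
  have hB : 0 < x ^ (-(2 * μ)) / s ^ ((1 : ℝ) / 2) := by positivity
  have hpow (p : ℝ) : (x ^ 2) ^ p = x ^ (2 * p) := by
    rw [← rpow_natCast_mul hx.le]; norm_num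
  have of_le (h : (s + t) ^ (-μ) ≤ 9 * (x ^ 2) ^ (-μ)) : (s + t) ^ (-μ) / s ^ ((1 : ℝ) / 2) ≤
      9 * (1 / x ^ (2 * μ + 1) + x ^ (-(2 * μ)) / s ^ ((1 : ℝ) / 2)) := by
    rw [hpow, mul_neg] at h
    calc (s + t) ^ (-μ) / s ^ ((1 : ℝ) / 2) ≤ 9 * x ^ (-(2 * μ)) / s ^ ((1 : ℝ) / 2) := by gcongr
      _ = 9 * (x ^ (-(2 * μ)) / s ^ ((1 : ℝ) / 2)) := mul_div_assoc _ _ _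
      _ ≤ _ := by linarith
  rcases le_total 0 μ with h0 | h0
  · refine of_le ?_
    have h1 : (s + t) ^ (-μ) ≤ (x ^ 2) ^ (-μ) :=
      rpow_le_rpow_of_nonpos hx2 (by linarith) (by linarith)
    have h2 : 0 < (x ^ 2) ^ (-μ) := by positivity
    linarith
  rcases le_total s (x ^ 2) with hsx | hsx
  · exact of_le <| (rpow_le_rpow (by linarith) (by linarith) (by linarith)).trans
      (nine_mul_rpow_neg_le hx2.le hμ)
  · calc (s + t) ^ (-μ) / s ^ ((1 : ℝ) / 2) ≤ 9 * s ^ (-μ) / s ^ ((1 : ℝ) / 2) := by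
          gcongr
          exact (rpow_le_rpow (by linarith) (by linarith) (by linarith)).trans
            (nine_mul_rpow_neg_le hs.le hμ)
      _ = 9 * s ^ (-μ - 1 / 2) := by rw [rpow_sub hs, mul_div_assoc]
      _ ≤ 9 * (x ^ 2) ^ (-μ - 1 / 2) := by
          gcongr 9 * ?_
          exact rpow_le_rpow_of_nonpos hx2 hsx (by linarith)
      _ = 9 * (1 / x ^ (2 * μ + 1)) := by
          rw [hpow, one_div (x ^ _), ← rpow_neg hx.le]
          ring_nf
      _ ≤ _ := by linarith

/-- Pointwise bound for the middle part of the kernel (x/(2r) ≤ y ≤ 4x/r). -/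
theorem K2_pointwise_bound (μ : ℝ) (hμ : -1 / 2 < μ) :
    ∃ C : ℝ, 0 < C ∧ ∀ x : ℝ, 0 < x → ∀ r : ℝ, 0 < r → r < 1 →
      ∀ y : ℝ, x / (2 * r) ≤ y → y ≤ 4 * x / r →
        ((1 - r ^ 2) ^ (μ + 1 / 2))⁻¹ * (1 + 2 * r * x * y / (1 - r ^ 2)) ^ (-μ) ≤
          C * (1 / x ^ (2 * μ + 1) + x ^ (-(2 * μ)) / (1 - r ^ 2) ^ ((1 : ℝ) / 2)) := by
  refine ⟨9, by norm_num, fun x hx r hr hr1 y hy1 hy2 => ?_⟩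
  have hs : 0 < 1 - r ^ 2 := by nlinarith
  rw [div_le_iff₀ (by positivity)] at hy1
  rw [le_div_iff₀ hr] at hy2
  have hxt : x ^ 2 ≤ 2 * r * x * y := by nlinarith
  have htx : 2 * r * x * y ≤ 8 * x ^ 2 := by nlinarith
  rw [inv_rpow_mul_one_add_div_rpow μ hs ((sq_nonneg x).trans hxt)]
  exact add_rpow_neg_div_rpow_half_le hμ hx hs hxt htx
end

section
/- There exists a constant C > 0 such that for every x > 0 and every r with 1/2 < r < 1, ∫_ℝ N(r,x,y) dλ(y) ≤ C x^{2μ} (1-r²)^{1/2} e^{-x²}, where N(r,x,y) = 1 if y ∈ [x, x/r], N(r,x,y) = e^{-(x-ry)²/(1-r²)} if y ∈ [x/(2r), 4x/r] \ [x, x/r], and N(r,x,y) = 0 otherwise. -/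
open MeasureTheory Real Set

/-- Completing the square: the Mehler-type weight times `exp (-y ^ 2)` is a Gaussian centred
at `r * x`. -/
theorem exp_mehler_mul_exp_neg_sq (x y : ℝ) {r : ℝ} (hr : 0 < 1 - r ^ 2) :
    Real.exp (-(x - r * y) ^ 2 / (1 - r ^ 2)) * Real.exp (-y ^ 2) =
      Real.exp (-x ^ 2) * Real.exp (-(1 - r ^ 2)⁻¹ * (y - r * x) ^ 2) := by
  rw [← Real.exp_add, ← Real.exp_add]
  congr 1
  field_simp
  ring

theorem exp_neg_sq_le_of_mem_Icc {x y r : ℝ} (hx : 0 < x) (hr : 1 / 2 < r) (hr1 : r < 1)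
    (hy : y ∈ Icc x (x / r)) :
    Real.exp (-y ^ 2) ≤ Real.exp (-x ^ 2) * Real.exp (-(1 - r ^ 2)⁻¹ * (y - x) ^ 2) := by
  obtain ⟨hxy, hyr⟩ := hy
  rw [le_div_iff₀ (by linarith)] at hyr
  have hs : 0 < 1 - r ^ 2 := by nlinarith
  rw [← Real.exp_add, Real.exp_le_exp]
  have key : (1 - r ^ 2)⁻¹ * (y - x) ^ 2 ≤ y ^ 2 - x ^ 2 := by
    rw [inv_mul_le_iff₀ hs]
    have h : y - x ≤ (1 - r ^ 2) * (y + x) := by nlinarith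
    nlinarith [mul_le_mul_of_nonneg_left h (sub_nonneg.2 hxy)]
  linarith

theorem rpow_le_rpow_abs_mul_rpow_s15 {x y K : ℝ} (hx : 0 < x) (hK : 1 ≤ K) (hl : x / K ≤ y)
    (hu : y ≤ K * x) (p : ℝ) : y ^ p ≤ K ^ |p| * x ^ p := by
  have hK0 : 0 < K := by linarith
  have hy : 0 < y := (div_pos hx hK0).trans_le hl
  rcases le_total 0 p with hp | hp
  · rw [abs_of_nonneg hp, ← Real.mul_rpow hK0.le hx.le]
    exact Real.rpow_le_rpow hy.le hu hp
  · rw [abs_of_nonpos hp, Real.rpow_neg hK0.le, mul_comm, ← div_eq_mul_inv,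
      ← Real.div_rpow hx.le hK0.le]
    exact Real.rpow_le_rpow_of_nonpos (div_pos hx hK0) hl hp

theorem integrable_exp_neg_mul_sub_sq {b : ℝ} (hb : 0 < b) (a : ℝ) :
    Integrable fun y : ℝ => Real.exp (-b * (y - a) ^ 2) :=
  (integrable_exp_neg_mul_sq hb).comp_sub_right a

theorem integral_exp_neg_inv_mul_sub_sq (s a : ℝ) :
    ∫ y : ℝ, Real.exp (-s⁻¹ * (y - a) ^ 2) = √π * √s := by
  rw [integral_sub_right_eq_self (fun y : ℝ => Real.exp (-s⁻¹ * y ^ 2)) a, integral_gaussian,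
    div_inv_eq_mul, Real.sqrt_mul Real.pi_pos.le]

theorem integral_lam (μ : ℝ) (f : ℝ → ℝ) :
    ∫ y, f y ∂(lam μ) = ∫ y, |y| ^ (2 * μ) * Real.exp (-y ^ 2) * f y := by
  rw [lam, integral_withDensity_eq_integral_toReal_smul (by fun_prop)
    (Filter.Eventually.of_forall fun _ => ENNReal.ofReal_lt_top)]
  refine integral_congr_ae (Filter.Eventually.of_forall fun y => ?_)
  simp only [smul_eq_mul]
  rw [ENNReal.toReal_ofReal (by positivity)]

open scoped Classical in
/-- The Natanson kernel N(r,x,·) satisfies ‖N(r,x,·)‖_{1,λ} ≤ C x^{2μ} (1-r²)^{1/2} e^{-x²}. -/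
theorem natanson_kernel_bound (μ : ℝ) (hμ : -1 / 2 < μ) :
    ∃ C : ℝ, 0 < C ∧ ∀ x : ℝ, 0 < x → ∀ r : ℝ, 1 / 2 < r → r < 1 →
      (∫ y, (if y ∈ Set.Icc x (x / r) then (1 : ℝ)
             else if y ∈ Set.Icc (x / (2 * r)) (4 * x / r) then
               Real.exp (-(x - r * y) ^ 2 / (1 - r ^ 2))
             else 0) ∂(lam μ)) ≤
        C * x ^ (2 * μ) * Real.sqrt (1 - r ^ 2) * Real.exp (-x ^ 2) := by
  refine ⟨2 * √π * 8 ^ |2 * μ|, by positivity, fun x hx r hr hr1 => ?_⟩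
  have hr0 : 0 < r := by linarith
  have hs : 0 < 1 - r ^ 2 := by nlinarith
  have hb : 0 < (1 - r ^ 2)⁻¹ := inv_pos.2 hs
  set M : ℝ := 8 ^ |2 * μ| * x ^ (2 * μ) * Real.exp (-x ^ 2) with hM
  have hM0 : 0 ≤ M := by positivity
  have hint := integrable_exp_neg_mul_sub_sq hb
  have hpow : ∀ y ∈ Icc (x / 8) (8 * x), |y| ^ (2 * μ) ≤ 8 ^ |2 * μ| * x ^ (2 * μ) := by
    intro y hy
    rw [abs_of_nonneg (le_trans (by positivity) hy.1)]
    exact rpow_le_rpow_abs_mul_rpow_s15 hx (by norm_num) hy.1 hy.2 _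
  rw [integral_lam]
  calc _ ≤ ∫ y, M * (Real.exp (-(1 - r ^ 2)⁻¹ * (y - x) ^ 2) +
        Real.exp (-(1 - r ^ 2)⁻¹ * (y - r * x) ^ 2)) := by
        refine integral_mono_of_nonneg (Filter.Eventually.of_forall fun y => ?_)
          (((hint x).add (hint (r * x))).const_mul M) (Filter.Eventually.of_forall fun y => ?_)
        · dsimp only [Pi.zero_apply]
          split_ifs <;> positivity
        · dsimp only
          split_ifs with h₁ h₂
          · have hy : y ∈ Icc (x / 8) (8 * x) := by
              refine ⟨by linarith [h₁.1], h₁.2.trans ?_⟩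
              rw [div_le_iff₀ hr0]
              nlinarith
            calc |y| ^ (2 * μ) * Real.exp (-y ^ 2) * 1
                ≤ 8 ^ |2 * μ| * x ^ (2 * μ) *
                  (Real.exp (-x ^ 2) * Real.exp (-(1 - r ^ 2)⁻¹ * (y - x) ^ 2)) := by
                  rw [mul_one]
                  exact mul_le_mul (hpow y hy) (exp_neg_sq_le_of_mem_Icc hx hr hr1 h₁)
                    (by positivity) (by positivity)
              _ = M * Real.exp (-(1 - r ^ 2)⁻¹ * (y - x) ^ 2) := by rw [hM]; ring
              _ ≤ _ := by
                  gcongr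
                  exact le_add_of_nonneg_right (Real.exp_pos _).le
          · have hy : y ∈ Icc (x / 8) (8 * x) := by
              refine ⟨le_trans ?_ h₂.1, h₂.2.trans ?_⟩
              · gcongr
                linarith
              · rw [div_le_iff₀ hr0]
                nlinarith
            rw [mul_assoc, mul_comm (Real.exp (-y ^ 2)), exp_mehler_mul_exp_neg_sq x y hs]
            calc |y| ^ (2 * μ) *
                  (Real.exp (-x ^ 2) * Real.exp (-(1 - r ^ 2)⁻¹ * (y - r * x) ^ 2))
                ≤ 8 ^ |2 * μ| * x ^ (2 * μ) *
                  (Real.exp (-x ^ 2) * Real.exp (-(1 - r ^ 2)⁻¹ * (y - r * x) ^ 2)) := by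
                  gcongr
                  exact hpow y hy
              _ = M * Real.exp (-(1 - r ^ 2)⁻¹ * (y - r * x) ^ 2) := by rw [hM]; ring
              _ ≤ _ := by
                  gcongr
                  exact le_add_of_nonneg_left (Real.exp_pos _).le
          · rw [mul_zero]
            positivity
    _ = _ := by
        rw [integral_const_mul, integral_add (hint x) (hint (r * x)),
          integral_exp_neg_inv_mul_sub_sq, integral_exp_neg_inv_mul_sub_sq, hM]
        ring
end
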